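/- arXiv:math/0512122 — 14 statements merged into one kernel-verified Lean document; each statement's English description precedes it below -/
import Mathlib

section
/- For every natural number n, a permutation σ of {1,…,n} avoids the barred pattern 3-1̄-42 if and only if it avoids the generalized pattern 23-1. Equivalently, S_n(3-1̄-42) = S_n(23-1). -/
/-- A permutation `σ` of `{1,…,n}` (encoded 0-based as `Equiv.Perm (Fin n)`)
avoids the barred pattern 3-1̄-42: for all positions `i < j` with `j+1 ≤ n`
satisfying `σ(j+1) < σ(i) < σ(j)`, there is `k` with `i < k < j` and `σ(k) < σ(j+1)`. -/
def Avoids3bar142 {n : ℕ} (σ : Equiv.Perm (Fin n)) : Prop :=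
  ∀ i j j' : Fin n, i < j → (j : ℕ) + 1 = (j' : ℕ) → σ j' < σ i → σ i < σ j →
    ∃ k : Fin n, i < k ∧ k < j ∧ σ k < σ j'

/-- `σ` avoids the generalized pattern 23-1: there are no positions `i`, `j` with
`i+1 < j ≤ n` such that `σ(j) < σ(i) < σ(i+1)`. -/
def Avoids23dash1 {n : ℕ} (σ : Equiv.Perm (Fin n)) : Prop :=
  ¬ ∃ i i' j : Fin n, (i : ℕ) + 1 = (i' : ℕ) ∧ i' < j ∧ σ j < σ i ∧ σ i < σ i'

theorem avoids3bar142_iff_avoids23dash1 (n : ℕ) (σ : Equiv.Perm (Fin n)) :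
    Avoids3bar142 σ ↔ Avoids23dash1 σ := by
  constructor
  · rintro h ⟨i, i', j, hi, hj, h1, h2⟩
    have key : ∀ m : ℕ, ∀ hm : m < n, (i' : ℕ) < m → σ i < σ ⟨m, hm⟩ := by
      intro m
      induction m using Nat.strong_induction_on with
      | _ m ih =>
        intro hm him
        by_contra hle
        have hne : σ ⟨m, hm⟩ ≠ σ i := by
          intro he
          have := congrArg Fin.val (σ.injective he)
          simp only at this
          omega
        have hlt : σ ⟨m, hm⟩ < σ i := lt_of_le_of_ne (not_lt.mp hle) hne
        have hp : m - 1 < n := by omega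
        have hprev : σ i < σ ⟨m - 1, hp⟩ := by
          by_cases hc : (i' : ℕ) = m - 1
          · have : i' = ⟨m - 1, hp⟩ := Fin.ext hc
            rwa [← this]
          · exact ih (m - 1) (by omega) hp (by omega)
        obtain ⟨k, hk1, hk2, hk3⟩ := h i ⟨m - 1, hp⟩ ⟨m, hm⟩
          (Fin.lt_def.mpr (by simp only; omega)) (by simp only; omega) hlt hprev
        have hk1' := Fin.lt_def.mp hk1
        have hk2' := Fin.lt_def.mp hk2
        simp only at hk2'
        have hki : σ k < σ i := hk3.trans hlt
        by_cases hc : i' = k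
        · subst hc
          exact lt_asymm hki h2
        · have hc' : (i' : ℕ) ≠ k := fun he => hc (Fin.ext he)
          exact lt_asymm hki (ih k (by omega) k.isLt (by omega))
    exact lt_asymm h1 (key j j.isLt hj)
  · intro h i j j' hij hjj h1 h2
    by_contra hno
    have hij' := Fin.lt_def.mp hij
    have key : ∀ m : ℕ, ∀ hm : m < n, (i : ℕ) ≤ m → m ≤ j → σ ⟨m, hm⟩ ≤ σ i := by
      intro m
      induction m with
      | zero =>
        intro hm him _
        have : (⟨0, hm⟩ : Fin n) = i := Fin.ext (by simp only; omega)
        rw [this]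
      | succ m ih =>
        intro hm him hmj
        by_cases hc : (i : ℕ) = m + 1
        · have : (⟨m + 1, hm⟩ : Fin n) = i := Fin.ext (by simp only; omega)
          rw [this]
        · have hm' : m < n := by omega
          have hle := ih hm' (by omega) (by omega)
          by_contra hgt
          have hasc : σ ⟨m, hm'⟩ < σ ⟨m + 1, hm⟩ := lt_of_le_of_lt hle (not_le.mp hgt)
          have hlow : σ j' < σ ⟨m, hm'⟩ := by
            by_cases him' : (i : ℕ) = m
            · have : i = ⟨m, hm'⟩ := Fin.ext him'
              rwa [← this]
            · by_contra hn
              have hne : σ ⟨m, hm'⟩ ≠ σ j' := by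
                intro he
                have := congrArg Fin.val (σ.injective he)
                simp only at this
                omega
              exact hno ⟨⟨m, hm'⟩, Fin.lt_def.mpr (by simp only; omega),
                Fin.lt_def.mpr (by simp only; omega), lt_of_le_of_ne (not_lt.mp hn) hne⟩
          exact h ⟨⟨m, hm'⟩, ⟨m + 1, hm⟩, j', rfl,
            Fin.lt_def.mpr (by simp only; omega), hlow, hasc⟩
    exact absurd h2 (not_lt.mpr (key j j.isLt hij'.le le_rfl))
end

section
/- For every natural number n, a permutation σ of {1,…,n} avoids the barred pattern 3-1̄-42 if and only if it avoids the barred pattern 3-1̄-4-2. Equivalently, S_n(3-1̄-42) = S_n(3-1̄-4-2). -/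
/-- `σ` avoids the barred pattern 3-1̄-4-2: for all positions `i < j < l` with
`σ(l) < σ(i) < σ(j)`, there is `k` with `i < k < j` and `σ(k) < σ(l)`. -/
def Avoids3bar1dash4dash2 {n : ℕ} (σ : Equiv.Perm (Fin n)) : Prop :=
  ∀ i j l : Fin n, i < j → j < l → σ l < σ i → σ i < σ j →
    ∃ k : Fin n, i < k ∧ k < j ∧ σ k < σ l

theorem avoids_aux {n : ℕ} (σ : Equiv.Perm (Fin n)) (h : Avoids3bar142 σ) :
    ∀ d : ℕ, ∀ i j l : Fin n, (j : ℕ) - i ≤ d → i < j → j < l → σ l < σ i → σ i < σ j →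
      ∃ k : Fin n, i < k ∧ k < j ∧ σ k < σ l := by
  intro d
  induction d with
  | zero => intro i j l hd hij; have : (i : ℕ) < j := hij; omega
  | succ d ih =>
    intro i j l hd hij hjl hli hlj
    have hex : ∃ m : ℕ, ∃ hm : m < n, (j : ℕ) < m ∧ σ ⟨m, hm⟩ < σ i := ⟨l, l.2, hjl, hli⟩
    classical
    obtain ⟨hm, hjm, hmi⟩ := Nat.find_spec hex
    have hmin : ∀ m' (hm' : m' < n), m' < Nat.find hex → (j : ℕ) < m' → σ i ≤ σ ⟨m', hm'⟩ := by
      intro m' hm' h1 h2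
      by_contra h3
      exact Nat.find_min hex h1 ⟨hm', h2, not_le.mp h3⟩
    generalize Nat.find hex = m at *
    have hij' : (i : ℕ) < j := hij
    have hge : ∀ k : Fin n, j ≤ k → (k : ℕ) < m → σ i < σ k := by
      intro k h1 h2
      rcases h1.eq_or_lt with rfl | h1
      · exact hlj
      · refine lt_of_le_of_ne (hmin k k.2 h2 h1) fun he => ?_
        have := σ.injective he
        subst this
        exact absurd h1 (not_lt.mpr hij.le)
    have hjp : j ≤ (⟨m - 1, by omega⟩ : Fin n) := by
      rw [Fin.le_def]; simp only; omega
    obtain ⟨k, hik, hkm, hk⟩ := h i ⟨m - 1, by omega⟩ ⟨m, hm⟩ (lt_of_lt_of_le hij hjp)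
      (by simp only; omega) hmi (hge _ hjp (by simp only; omega))
    have hki : σ k < σ i := hk.trans hmi
    have hkj : k < j := by
      by_contra hc
      have hkm' : (k : ℕ) < m - 1 := hkm
      exact absurd (hge k (not_lt.mp hc) (by omega)) (not_lt.mpr hki.le)
    have hik' : (i : ℕ) < k := hik
    have hkj' : (k : ℕ) < j := hkj
    rcases lt_trichotomy (σ k) (σ l) with h1 | h1 | h1
    · exact ⟨k, hik, hkj, h1⟩
    · have := σ.injective h1
      subst this
      exact absurd hkj (not_lt.mpr hjl.le)
    · obtain ⟨k', h2, h3, h4⟩ := ih k j l (by omega) hkj hjl h1 (hki.trans hlj)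
      exact ⟨k', hik.trans h2, h3, h4⟩

theorem avoids3bar142_iff_avoids3bar1dash4dash2 (n : ℕ) (σ : Equiv.Perm (Fin n)) :
    Avoids3bar142 σ ↔ Avoids3bar1dash4dash2 σ := by
  constructor
  · intro h i j l
    exact avoids_aux σ h _ i j l le_rfl
  · intro h i j j' hij hj
    exact h i j j' hij (by rw [Fin.lt_def]; omega)
end

section
/- For every natural number n, the number of permutations of {1,…,n} avoiding the barred pattern 3-1̄-42 equals the n-th Bell number, i.e., the number of set partitions of an n-element set. -/
def BellMinFun (n : ℕ) : Type :=
  {f : Fin n → Fin n // (∀ a, f a ≤ a) ∧ ∀ a, f (f a) = f a}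

/-- The suffix minimum, as a function of the value. -/
def bellSuf {n : ℕ} (σ : Equiv.Perm (Fin n)) (v : Fin n) : Fin n :=
  (Finset.Ici (σ.symm v)).inf' ⟨_, Finset.mem_Ici.2 le_rfl⟩ σ

theorem bellSuf_le {n : ℕ} (σ : Equiv.Perm (Fin n)) (p q : Fin n) (h : p ≤ q) :
    bellSuf σ (σ p) ≤ σ q := by
  unfold bellSuf
  exact Finset.inf'_le _ (by simpa using h)

theorem bellSuf_exists {n : ℕ} (σ : Equiv.Perm (Fin n)) (p : Fin n) :
    ∃ e, p ≤ e ∧ bellSuf σ (σ p) = σ e := by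
  obtain ⟨e, he, h⟩ := Finset.exists_mem_eq_inf' (s := Finset.Ici (σ.symm (σ p)))
    ⟨_, Finset.mem_Ici.2 le_rfl⟩ σ
  exact ⟨e, by simpa using he, h⟩

theorem bellSuf_eq {n : ℕ} (σ : Equiv.Perm (Fin n)) (p e : Fin n) (hp : p ≤ e)
    (h : ∀ q, p ≤ q → σ e ≤ σ q) : bellSuf σ (σ p) = σ e := by
  obtain ⟨e', h1, h2⟩ := bellSuf_exists σ p
  exact le_antisymm (bellSuf_le σ p e hp) (h2 ▸ h e' h1)

theorem bellSuf_prop {n : ℕ} (σ : Equiv.Perm (Fin n)) :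
    (∀ a, bellSuf σ a ≤ a) ∧ ∀ a, bellSuf σ (bellSuf σ a) = bellSuf σ a := by
  have key : ∀ p, bellSuf σ (σ p) ≤ σ p ∧
      bellSuf σ (bellSuf σ (σ p)) = bellSuf σ (σ p) := by
    intro p
    refine ⟨bellSuf_le σ p p le_rfl, ?_⟩
    obtain ⟨e, h1, h2⟩ := bellSuf_exists σ p
    rw [h2]
    exact bellSuf_eq σ e e le_rfl fun q hq => h2 ▸ bellSuf_le σ p q (h1.trans hq)
  constructor
  · intro a; simpa using (key (σ.symm a)).1
  · intro a; simpa using (key (σ.symm a)).2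

/-- Sort key: blocks by increasing minimum, each block decreasing. -/
def bellKey {n : ℕ} (f : Fin n → Fin n) (a : Fin n) : Lex (Fin n × ℤ) :=
  toLex (f a, -(a : ℤ))

theorem bellKey_lt {n : ℕ} (f : Fin n → Fin n) (a b : Fin n) :
    bellKey f a < bellKey f b ↔ f a < f b ∨ (f a = f b ∧ b < a) := by
  unfold bellKey
  rw [Prod.Lex.toLex_lt_toLex]
  simp

theorem bellKey_inj {n : ℕ} (f : Fin n → Fin n) : Function.Injective (bellKey f) := by
  intro a b h
  simp only [bellKey, EmbeddingLike.apply_eq_iff_eq, Prod.mk.injEq, neg_inj] at h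
  exact Fin.ext (by exact_mod_cast h.2)

/-- In an avoider, each block is decreasing. -/
theorem bell_block {n : ℕ} (σ : Equiv.Perm (Fin n)) (hσ : Avoids3bar142 σ) :
    ∀ (m : ℕ) (p q : Fin n), n - (p : ℕ) = m → p < q →
      bellSuf σ (σ p) = bellSuf σ (σ q) → σ q < σ p := by
  intro m
  induction m using Nat.strong_induction_on with
  | _ m ih =>
  intro p q hm hpq hf
  by_contra hcon
  have hlt : σ p < σ q := lt_of_le_of_ne (not_lt.1 hcon) (fun h => hpq.ne (σ.injective h))
  obtain ⟨e, he1, he2⟩ := bellSuf_exists σ q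
  have hep : σ e ≤ σ p := by rw [← he2, ← hf]; exact bellSuf_le σ p p le_rfl
  -- every position of (p, e] has the same suffix minimum
  have hsame : ∀ r, p ≤ r → r ≤ e → bellSuf σ (σ r) = σ e := by
    intro r h1 h2
    refine bellSuf_eq σ r e h2 fun s hs => ?_
    rw [← he2, ← hf]
    exact bellSuf_le σ p s (h1.trans hs)
  -- the last position j in [q, e] with σ p < σ j
  let S := (Finset.Icc q e).filter (fun j => σ p < σ j)
  have hS : S.Nonempty := ⟨q, by simp [S, he1, hlt]⟩
  obtain ⟨j, hjS, hjmax⟩ := S.exists_max_image id hS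
  simp only [S, Finset.mem_filter, Finset.mem_Icc] at hjS hjmax
  obtain ⟨⟨hqj, hje⟩, hpj⟩ := hjS
  have hjne : j < e := lt_of_le_of_ne hje (by rintro rfl; exact absurd hpj (not_lt.2 hep))
  have hj1 : (j : ℕ) + 1 < n := by have := e.2; have := Fin.lt_def.1 hjne; omega
  let j' : Fin n := ⟨j + 1, hj1⟩
  have hjj' : j < j' := Fin.lt_def.2 (by simp [j'])
  have hj'e : j' ≤ e := Fin.le_def.2 (by have := Fin.lt_def.1 hjne; simp [j']; omega)
  have hpj' : p < j' := hpq.trans_le (hqj.trans hjj'.le)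
  have h1 : σ j' ≤ σ p := by
    by_contra h
    exact absurd (hjmax j' ⟨⟨hqj.trans hjj'.le, hj'e⟩, not_le.1 h⟩) (not_le.2 hjj')
  have h2 : σ j' < σ p := lt_of_le_of_ne h1 fun h => hpj'.ne' (σ.injective h)
  obtain ⟨k, hk1, hk2, hk3⟩ := hσ p j j' (hpq.trans_le hqj) rfl h2 hpj
  have hkj' := hk2.trans hjj'
  have h3 := ih (n - (k : ℕ)) (by have := k.2; have := Fin.lt_def.1 hk1; omega) k j' rfl hkj'
    (by rw [hsame k hk1.le (hkj'.le.trans hj'e), hsame j' hpj'.le hj'e])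
  exact absurd h3 hk3.asymm

theorem bell_mono {n : ℕ} (σ : Equiv.Perm (Fin n)) (hσ : Avoids3bar142 σ) :
    StrictMono (bellKey (bellSuf σ) ∘ σ) := by
  intro p q hpq
  simp only [Function.comp, bellKey_lt]
  have h : bellSuf σ (σ p) ≤ bellSuf σ (σ q) := by
    obtain ⟨e, h1, h2⟩ := bellSuf_exists σ q
    rw [h2]; exact bellSuf_le σ p e (hpq.le.trans h1)
  rcases h.lt_or_eq with h | h
  · exact Or.inl h
  · exact Or.inr ⟨h, bell_block σ hσ _ p q rfl hpq h⟩

theorem bell_card_perm (n : ℕ) :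
    Nat.card {σ : Equiv.Perm (Fin n) // Avoids3bar142 σ} = Nat.card (BellMinFun n) := by
  refine Nat.card_eq_of_bijective (fun σ => (⟨bellSuf σ.1, bellSuf_prop σ.1⟩ : BellMinFun n))
    ⟨?_, ?_⟩
  · rintro ⟨σ, hσ⟩ ⟨τ, hτ⟩ h
    have h' : bellSuf σ = bellSuf τ := congrArg Subtype.val h
    have h1 := (bell_mono σ hσ).monotone
    have h2 := (bell_mono τ hτ).monotone
    rw [← h'] at h2
    have h3 := Tuple.unique_monotone h1 h2
    apply Subtype.ext
    ext1 x
    exact bellKey_inj _ (congrFun h3 x)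
  · rintro ⟨f, hf1, hf2⟩
    let σ := Tuple.sort (bellKey f)
    have hmono : StrictMono (bellKey f ∘ σ) :=
      (Tuple.monotone_sort (bellKey f)).strictMono_of_injective
        ((bellKey_inj f).comp σ.injective)
    have hlt : ∀ p q, p < q ↔ f (σ p) < f (σ q) ∨ (f (σ p) = f (σ q) ∧ σ q < σ p) := by
      intro p q
      rw [← bellKey_lt, ← hmono.lt_iff_lt]; rfl
    have hle : ∀ p q, p ≤ q → f (σ p) ≤ f (σ q) := by
      intro p q h
      rcases h.lt_or_eq with h | rfl
      · rcases (hlt p q).1 h with h | h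
        · exact h.le
        · exact h.1.le
      · exact le_rfl
    have hav : Avoids3bar142 σ := by
      intro i j j' hij hj h1 h2
      have hjj' : j < j' := Fin.lt_def.2 (by omega)
      have hs : ∀ x, σ (σ.symm x) = x := fun x => by simp
      have e1 : f (σ j) = f (σ j') := by
        rcases (hlt j j').1 hjj' with h | h
        · exfalso
          have a1 : j < σ.symm (f (σ j)) := by
            rw [hlt, hs, hf2]
            exact Or.inr ⟨rfl, (h.trans_le (hf1 _)).trans (h1.trans h2)⟩
          have a2 : σ.symm (f (σ j)) < j' := by
            rw [hlt, hs, hf2]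
            exact Or.inl h
          have := Fin.lt_def.1 a1
          have := Fin.lt_def.1 a2
          omega
        · exact h.1
      have e2 : f (σ i) < f (σ j) := by
        rcases (hlt i j).1 hij with h | h
        · exact h
        · exact absurd h.2 h2.asymm
      have e3 : f (σ i) < σ j' := e2.trans_le (e1 ▸ hf1 _)
      refine ⟨σ.symm (f (σ i)), ?_, ?_, ?_⟩
      · rw [hlt, hs, hf2]
        exact Or.inr ⟨rfl, e3.trans h1⟩
      · rw [hlt, hs, hf2]
        exact Or.inl e2
      · rw [hs]; exact e3
    refine ⟨⟨σ, hav⟩, Subtype.ext (funext fun v => ?_)⟩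
    change bellSuf σ v = f v
    obtain ⟨p, rfl⟩ := σ.surjective v
    have h0 : p ≤ σ.symm (f (σ p)) := by
      rw [← not_lt, hlt]
      simp only [Equiv.apply_symm_apply, hf2, lt_irrefl, false_or, true_and, not_lt]
      exact hf1 _
    have := bellSuf_eq σ p (σ.symm (f (σ p))) h0 (by
      intro q hq
      simp only [Equiv.apply_symm_apply]
      exact (hle p q hq).trans (hf1 _))
    simpa using this

theorem bell_card_part (n : ℕ) :
    Nat.card (Finpartition (Finset.univ : Finset (Fin n))) = Nat.card (BellMinFun n) := by
  classical
  have hne : ∀ (P : Finpartition (Finset.univ : Finset (Fin n))) a, (P.part a).Nonempty :=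
    fun P a => ⟨a, P.mem_part (Finset.mem_univ a)⟩
  have hpart : ∀ (P : Finpartition (Finset.univ : Finset (Fin n))) a b,
      b ∈ P.part a → P.part b = P.part a := fun P a b h =>
    P.part_eq_of_mem (P.part_mem.2 (Finset.mem_univ a)) h
  have hmin : ∀ (P : Finpartition (Finset.univ : Finset (Fin n))) a,
      P.part ((P.part a).min' (hne P a)) = P.part a := fun P a =>
    hpart P a _ (Finset.min'_mem _ _)
  refine Nat.card_eq_of_bijective (fun P => (⟨fun a => (P.part a).min' (hne P a), ?_, ?_⟩ :
    BellMinFun n)) ⟨?_, ?_⟩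
  · intro a
    exact Finset.min'_le _ _ (P.mem_part (Finset.mem_univ a))
  · intro a
    simp only [hmin]
  · intro P Q h
    have h' : ∀ a, (P.part a).min' (hne P a) = (Q.part a).min' (hne Q a) :=
      fun a => congrFun (congrArg Subtype.val h) a
    have aux : ∀ (P Q : Finpartition (Finset.univ : Finset (Fin n))),
        (∀ a, (P.part a).min' (hne P a) = (Q.part a).min' (hne Q a)) →
        ∀ a, P.part a ⊆ Q.part a := by
      intro P Q h a b hb
      have e := hpart P a b hb
      have h1 : (P.part b).min' (hne P b) = (P.part a).min' (hne P a) := by simp only [e]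
      rw [h, h] at h1
      have h2 := hmin Q b
      rw [h1, hmin Q a] at h2
      rw [h2]
      exact Q.mem_part (Finset.mem_univ b)
    have hpq : ∀ a, P.part a = Q.part a := fun a =>
      Finset.Subset.antisymm (aux P Q h' a) (aux Q P (fun a => (h' a).symm) a)
    have aux2 : ∀ (P Q : Finpartition (Finset.univ : Finset (Fin n))),
        (∀ a, P.part a = Q.part a) → P.parts ⊆ Q.parts := by
      intro P Q h s hs
      obtain ⟨a, ha⟩ := P.nonempty_of_mem_parts hs
      rw [← P.part_eq_of_mem hs ha, h]
      exact Q.part_mem.2 (Finset.mem_univ a)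
    exact Finpartition.ext (Finset.Subset.antisymm (aux2 P Q hpq)
      (aux2 Q P fun a => (hpq a).symm))
  · rintro ⟨f, hf1, hf2⟩
    refine ⟨Finpartition.ofSetoid (Setoid.ker f), Subtype.ext (funext fun a => ?_)⟩
    have hm : ∀ a b, b ∈ (Finpartition.ofSetoid (Setoid.ker f)).part a ↔ f a = f b := by
      intro a b
      rw [Finpartition.mem_part_ofSetoid_iff_rel]
      rfl
    change Finset.min' _ (hne _ a) = f a
    apply le_antisymm
    · exact Finset.min'_le _ _ ((hm _ _).2 (hf2 a).symm)
    · apply Finset.le_min'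
      intro b hb
      rw [(hm _ _).1 hb]
      exact hf1 b

theorem card_avoids3bar142_eq_bell (n : ℕ) :
    Nat.card {σ : Equiv.Perm (Fin n) // Avoids3bar142 σ} =
      Nat.card (Finpartition (Finset.univ : Finset (Fin n))) := by
  rw [bell_card_perm, bell_card_part]
end

section
/- For every natural number n, a permutation σ of {1,…,n} avoids the barred pattern 31-4̄-2 if and only if it avoids the generalized pattern 3-12. Equivalently, S_n(31-4̄-2) = S_n(3-12). -/
/-- `σ` avoids the barred pattern 31-4̄-2 (positions 0-based): for all positions `i`, `j`
with `i+1 < j` and `σ(i+1) < σ(j) < σ(i)`, there is `k` with `i+1 < k < j` and `σ(k) > σ(i)`. -/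
def Avoids31bar4dash2 {n : ℕ} (σ : Equiv.Perm (Fin n)) : Prop :=
  ∀ i i' j : Fin n, (i : ℕ) + 1 = (i' : ℕ) → i' < j → σ i' < σ j → σ j < σ i →
    ∃ k : Fin n, i' < k ∧ k < j ∧ σ i < σ k

/-- `σ` avoids the generalized pattern 3-12: there are no positions `i < j` with
`j+1 ≤ n` such that `σ(j) < σ(j+1) < σ(i)`. -/
def Avoids3dash12 {n : ℕ} (σ : Equiv.Perm (Fin n)) : Prop :=
  ¬ ∃ i j j' : Fin n, i < j ∧ (j : ℕ) + 1 = (j' : ℕ) ∧ σ j < σ j' ∧ σ j' < σ i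

lemma exists_last_fin {n : ℕ} (P : Fin n → Prop) (a : Fin n) (ha : P a) :
    ∃ m, P m ∧ ∀ k, P k → k ≤ m := by
  classical
  obtain ⟨m, hm, hmax⟩ := Finset.exists_max_image (Finset.univ.filter P) id ⟨a, by simp [ha]⟩
  exact ⟨m, by simpa using hm, fun k hk => hmax k (by simp [hk])⟩

theorem avoids31bar4dash2_iff_avoids3dash12 (n : ℕ) (σ : Equiv.Perm (Fin n)) :
    Avoids31bar4dash2 σ ↔ Avoids3dash12 σ := by
  constructor
  · rintro h ⟨i, j, j', hij, hj, h1, h2⟩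
    obtain ⟨k, ⟨hkj, hkv⟩, hmax⟩ :=
      exists_last_fin (fun k => k < j ∧ σ j' < σ k) i ⟨hij, h2⟩
    have hlt : (k : ℕ) + 1 < n := by have := j.isLt; omega
    let k' : Fin n := ⟨(k : ℕ) + 1, hlt⟩
    have hk'j : k' ≤ j := by rw [Fin.le_def]; simp only [k']; omega
    have hk'j' : k' < j' := by rw [Fin.le_def] at hk'j; omega
    have hv : σ k' < σ j' := by
      by_contra hc
      have hne : σ j' ≠ σ k' := fun e => hk'j'.ne' (σ.injective e)
      have hgt : σ j' < σ k' := lt_of_le_of_ne (not_lt.mp hc) hne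
      have hne2 : k' ≠ j := by
        intro e
        rw [e] at hgt
        exact lt_asymm hgt h1
      have := hmax k' ⟨lt_of_le_of_ne hk'j hne2, hgt⟩
      rw [Fin.le_def] at this
      simp only [k'] at this
      omega
    obtain ⟨m, hm1, hm2, hm3⟩ := h k k' j' rfl hk'j' hv hkv
    have hmv : σ j' < σ m := hkv.trans hm3
    have hne : m ≠ j := by
      intro e
      rw [e] at hmv
      exact lt_asymm hmv h1
    have hmj : m < j := lt_of_le_of_ne (by rw [Fin.le_def]; omega) hne
    have := hmax m ⟨hmj, hmv⟩
    rw [Fin.lt_def] at hm1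
    rw [Fin.le_def] at this
    simp only [k'] at hm1
    omega
  · intro h i i' j hi hij h1 h2
    by_contra hc
    push Not at hc
    obtain ⟨m, ⟨hm1, hm2, hmv⟩, hmax⟩ :=
      exists_last_fin (fun k => i' ≤ k ∧ k < j ∧ σ k < σ j) i' ⟨le_rfl, hij, h1⟩
    have hlt : (m : ℕ) + 1 < n := by have := j.isLt; omega
    let m' : Fin n := ⟨(m : ℕ) + 1, hlt⟩
    have hmm' : m < m' := by rw [Fin.lt_def]; simp only [m']; omega
    have hm'j : m' ≤ j := by rw [Fin.le_def]; simp only [m']; omega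
    have him : i < m := by rw [Fin.le_def] at hm1; rw [Fin.lt_def]; omega
    refine h ⟨i, m, m', him, rfl, ?_, ?_⟩
    · by_contra hd
      have hv : σ m' < σ j := lt_of_le_of_lt (not_lt.mp hd) hmv
      have hne : m' ≠ j := fun e => by simp [e] at hv
      exact absurd (hmax m' ⟨hm1.trans hmm'.le, lt_of_le_of_ne hm'j hne, hv⟩) (not_le.mpr hmm')
    · rcases eq_or_lt_of_le hm'j with e | hl
      · rw [e]; exact h2
      · refine lt_of_le_of_ne (hc m' (lt_of_le_of_lt hm1 hmm') hl) ?_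
        intro e
        exact (him.trans hmm').ne' (σ.injective e)
end

section
/- For every natural number n, a permutation σ of {1,…,n} avoids the barred pattern 31-4̄-2 if and only if it avoids the barred pattern 3-1-4̄-2. Equivalently, S_n(31-4̄-2) = S_n(3-1-4̄-2). -/
/-- `σ` avoids the barred pattern 3-1-4̄-2: for all positions `i < j < l` with
`σ(j) < σ(l) < σ(i)`, there is `k` with `j < k < l` and `σ(k) > σ(i)`. -/
def Avoids3dash1bar4dash2 {n : ℕ} (σ : Equiv.Perm (Fin n)) : Prop :=
  ∀ i j l : Fin n, i < j → j < l → σ j < σ l → σ l < σ i →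
    ∃ k : Fin n, j < k ∧ k < l ∧ σ i < σ k

theorem avoids31bar4dash2_iff_avoids3dash1bar4dash2 (n : ℕ) (σ : Equiv.Perm (Fin n)) :
    Avoids31bar4dash2 σ ↔ Avoids3dash1bar4dash2 σ := by
  constructor
  · intro h i j l hij
    induction l using WellFoundedLT.induction with
    | ind l ih =>
      intro hjl h1 h2
      -- the last position `m < j` with `σ m > σ l`
      obtain ⟨m, hm, hmax⟩ := Finset.exists_max_image
        (Finset.univ.filter (fun m : Fin n => m < j ∧ σ l < σ m)) id ⟨i, by simp [hij, h2]⟩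
      simp only [Finset.mem_filter, Finset.mem_univ, true_and, id] at hm hmax
      obtain ⟨hmj, hml⟩ := hm
      have hlow : ∀ x : Fin n, m < x → x ≤ j → σ x < σ l := by
        intro x hx hxj
        rcases hxj.eq_or_lt with rfl | hlt
        · exact h1
        · by_contra hc
          have hne : σ l ≠ σ x := fun e => (hlt.trans hjl).ne (σ.injective e).symm
          exact absurd (hmax x ⟨hlt, lt_of_le_of_ne (not_lt.mp hc) hne⟩) (not_le.mpr hx)
      have hb : (m : ℕ) + 1 < n := by have := j.2; have : (m : ℕ) < j := hmj; omega
      have hs : (⟨m + 1, hb⟩ : Fin n) ≤ j := by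
        have : (m : ℕ) < j := hmj
        exact this
      have hms : m < (⟨m + 1, hb⟩ : Fin n) := Nat.lt_succ_self m
      obtain ⟨k, hk1, hk2, hk3⟩ := h m ⟨m + 1, hb⟩ l rfl (lt_of_le_of_lt hs hjl)
        (hlow _ hms hs) hml
      have hjk : j < k := by
        by_contra hc
        exact absurd (hlow k (hms.trans hk1) (not_lt.mp hc)) (not_lt.mpr (hml.trans hk3).le)
      rcases lt_trichotomy (σ i) (σ k) with hlt | heq | hgt
      · exact ⟨k, hjk, hk2, hlt⟩
      · exact absurd (σ.injective heq) (hij.trans hjk).ne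
      · obtain ⟨k', a, b, c⟩ := ih k hk2 hjk (h1.trans (hml.trans hk3)) hgt
        exact ⟨k', a, b.trans hk2, c⟩
  · intro h i i' j hi
    exact h i i' j (by rw [Fin.lt_def]; omega)
end

section
/- For every natural number n, the number of permutations of {1,…,n} avoiding the barred pattern 31-4̄-2 equals the n-th Bell number, i.e., the number of set partitions of an n-element set. -/
/-- running maximum condition: `m` is the value of the maximum up to the position of `x`. -/
def RunMaxB {n : ℕ} (σ : Equiv.Perm (Fin n)) (g : Fin n → Fin n) : Prop :=
  ∀ p : Fin n, (∃ k ≤ p, σ k = g (σ p)) ∧ ∀ k ≤ p, σ k ≤ g (σ p)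

theorem exists_runMaxB {n : ℕ} (σ : Equiv.Perm (Fin n)) : ∃ g, RunMaxB σ g := by
  have h : ∀ x : Fin n, ∃ y, (∃ k ≤ σ.symm x, σ k = y) ∧ ∀ k ≤ σ.symm x, σ k ≤ y := by
    intro x
    obtain ⟨k, hk, hk'⟩ := Finset.exists_max_image (Finset.Iic (σ.symm x)) σ ⟨σ.symm x, by simp⟩
    exact ⟨σ k, ⟨k, by simpa using hk, rfl⟩, fun j hj => hk' j (by simpa using hj)⟩
  choose g hg using h
  exact ⟨g, fun p => by simpa using hg (σ p)⟩

theorem RunMaxB.unique {n : ℕ} {σ : Equiv.Perm (Fin n)} {g g' : Fin n → Fin n}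
    (h : RunMaxB σ g) (h' : RunMaxB σ g') : g = g' := by
  funext x
  obtain ⟨p, rfl⟩ := σ.surjective x
  obtain ⟨⟨k, hk, e⟩, h2⟩ := h p
  obtain ⟨⟨k', hk', e'⟩, h2'⟩ := h' p
  exact le_antisymm (e ▸ h2' k hk) (e' ▸ h2 k' hk')

/-- class-maximum functions -/
def MaxFunB {n : ℕ} (g : Fin n → Fin n) : Prop := ∀ x, x ≤ g x ∧ g (g x) = g x

theorem RunMaxB.maxFunB {n : ℕ} {σ : Equiv.Perm (Fin n)} {g : Fin n → Fin n}
    (h : RunMaxB σ g) : MaxFunB g := by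
  intro x
  obtain ⟨p, rfl⟩ := σ.surjective x
  obtain ⟨⟨k, hk, e⟩, h2⟩ := h p
  refine ⟨h2 p le_rfl, ?_⟩
  obtain ⟨⟨k', hk', e'⟩, h2'⟩ := h k
  rw [← e]
  apply le_antisymm
  · rw [← e', e]; exact h2 _ (hk'.trans hk)
  · exact h2' k le_rfl

theorem decr_after_max {n : ℕ} {σ : Equiv.Perm (Fin n)} (ha : Avoids31bar4dash2 σ)
    (k : Fin n) : ∀ (d : ℕ) (p : Fin n), (p : ℕ) = k + d → ∀ q, p < q →
      (∀ r ≤ q, σ r ≤ σ k) → σ q < σ p := by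
  intro d
  induction d with
  | zero =>
    intro p hp q hq h
    have : p = k := Fin.ext (by simpa using hp)
    subst this
    exact lt_of_le_of_ne (h q le_rfl) (fun e => hq.ne' (σ.injective e))
  | succ d ih =>
    intro p hp q hq h
    have hb : (k : ℕ) + d < n := by have := p.2; omega
    let p0 : Fin n := ⟨k + d, hb⟩
    have hp0 : p0 < p := by rw [Fin.lt_def]; simp only [p0]; omega
    by_contra hcon
    have hlt : σ p < σ q :=
      lt_of_le_of_ne (not_lt.1 hcon) (fun e => hq.ne (σ.injective e))
    obtain ⟨r, h1, h2, h3⟩ := ha p0 p q (by simp only [p0]; omega) hq hlt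
      (ih p0 rfl q (hp0.trans hq) h)
    exact absurd h3 (not_lt.2 (ih p0 rfl r (hp0.trans h1)
      (fun s hs => h s (hs.trans h2.le))).le)

theorem key_of_lt {n : ℕ} {σ : Equiv.Perm (Fin n)} {g : Fin n → Fin n}
    (ha : Avoids31bar4dash2 σ) (h : RunMaxB σ g) {p q : Fin n} (hpq : p < q) :
    g (σ p) < g (σ q) ∨ (g (σ p) = g (σ q) ∧ σ q < σ p) := by
  obtain ⟨⟨k, hk, e⟩, h2⟩ := h p
  obtain ⟨_, h2'⟩ := h q
  rcases lt_or_eq_of_le (e ▸ h2' k (hk.trans hpq.le) : g (σ p) ≤ g (σ q)) with hl | he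
  · exact Or.inl hl
  · refine Or.inr ⟨he, decr_after_max ha k (p - k) p ?_ q hpq ?_⟩
    · have : (k : ℕ) ≤ p := hk
      omega
    · intro r hr; rw [e, he]; exact h2' r hr

theorem avoid_inj {n : ℕ} {σ τ : Equiv.Perm (Fin n)} {g : Fin n → Fin n}
    (ha : Avoids31bar4dash2 σ) (hb : Avoids31bar4dash2 τ)
    (h : RunMaxB σ g) (h' : RunMaxB τ g) : σ = τ := by
  have hm : StrictMono (fun p => τ.symm (σ p)) := by
    intro p q hpq
    by_contra hcon
    have h1 : τ.symm (σ q) < τ.symm (σ p) := by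
      refine lt_of_le_of_ne (not_lt.1 hcon) fun e => hpq.ne' (σ.injective (τ.symm.injective e))
    have a := key_of_lt ha h hpq
    have b := key_of_lt hb h' h1
    simp only [Equiv.apply_symm_apply] at b
    rcases a with a | ⟨a, a'⟩ <;> rcases b with b | ⟨b, b'⟩ <;> order
  let e : Fin n ≃o Fin n := StrictMono.orderIsoOfSurjective _ hm
    ((τ.symm.surjective).comp σ.surjective)
  have he : e = OrderIso.refl _ := Subsingleton.elim _ _
  ext1 p
  have : τ.symm (σ p) = p := DFunLike.congr_fun he p
  rw [Equiv.symm_apply_eq] at this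
  exact this

theorem avoid_surj {n : ℕ} {g : Fin n → Fin n} (hg : MaxFunB g) :
    ∃ σ : Equiv.Perm (Fin n), Avoids31bar4dash2 σ ∧ RunMaxB σ g := by
  let key : Fin n → Fin n ×ₗ (Fin n)ᵒᵈ := fun x => toLex (g x, OrderDual.toDual x)
  have hinj : Function.Injective key := by
    intro x y h
    have := congrArg (fun z => (ofLex z).2) h
    exact this
  let σ := Tuple.sort key
  have hmono : StrictMono (key ∘ σ) :=
    (Tuple.monotone_sort key).strictMono_of_injective (hinj.comp σ.injective)
  have hlt : ∀ p q, p < q ↔ (g (σ p) < g (σ q) ∨ (g (σ p) = g (σ q) ∧ σ q < σ p)) := by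
    intro p q
    rw [← hmono.lt_iff_lt]
    simp only [key, Function.comp, Prod.Lex.toLex_lt_toLex, OrderDual.toDual_lt_toDual]
  have hpos : ∀ p, ∃ k ≤ p, σ k = g (σ p) := by
    intro p
    refine ⟨σ.symm (g (σ p)), ?_, by simp⟩
    rw [← not_lt, hlt]
    simp only [Equiv.apply_symm_apply, (hg _).2]
    have := (hg (σ p)).1
    rintro (h | ⟨_, h⟩) <;> order
  have hle : ∀ p q, p ≤ q → g (σ p) ≤ g (σ q) := by
    intro p q h
    rcases h.lt_or_eq with h | rfl
    · rcases (hlt p q).1 h with h | h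
      · exact h.le
      · exact h.1.le
    · exact le_rfl
  refine ⟨σ, ?_, fun p => ⟨hpos p, fun k hk => (hg _).1.trans (hle k p hk)⟩⟩
  intro i i' j hi hj h1 h2
  have hii : i < i' := by rw [Fin.lt_def]; omega
  have h3 : g (σ i') < g (σ j) := by
    rcases (hlt _ _).1 hj with h | h
    · exact h
    · exact absurd h.2 (not_lt.2 h1.le)
  have h4 := hle _ _ hii.le
  have h5 := (hg (σ i)).1
  obtain ⟨k, hk, e⟩ := hpos j
  have h6 : σ i < σ k := by rw [e]; order
  refine ⟨k, ?_, lt_of_le_of_ne hk ?_, h6⟩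
  · rw [hlt]; left; rw [e, (hg _).2]; exact h3
  · rintro rfl; order

theorem card_left {n : ℕ} : Nat.card {σ : Equiv.Perm (Fin n) // Avoids31bar4dash2 σ} =
    Nat.card {g : Fin n → Fin n // MaxFunB g} := by
  refine Nat.card_eq_of_bijective (fun σ => ⟨(exists_runMaxB σ.1).choose,
    (exists_runMaxB σ.1).choose_spec.maxFunB⟩) ⟨?_, ?_⟩
  · rintro ⟨σ, hσ⟩ ⟨τ, hτ⟩ h
    have h := congrArg Subtype.val h
    dsimp only at h
    apply Subtype.ext
    exact avoid_inj hσ hτ (exists_runMaxB σ).choose_spec (h ▸ (exists_runMaxB τ).choose_spec)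
  · rintro ⟨g, hg⟩
    obtain ⟨σ, h, h'⟩ := avoid_surj hg
    exact ⟨⟨σ, h⟩, Subtype.ext ((exists_runMaxB σ).choose_spec.unique h')⟩

open Classical in
theorem card_right {n : ℕ} : Nat.card (Finpartition (Finset.univ : Finset (Fin n))) =
    Nat.card {g : Fin n → Fin n // MaxFunB g} := by
  have hne : ∀ (P : Finpartition (Finset.univ : Finset (Fin n))) x, (P.part x).Nonempty :=
    fun P x => ⟨x, P.mem_part (Finset.mem_univ x)⟩
  have hpart : ∀ (P : Finpartition (Finset.univ : Finset (Fin n))) x y,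
      y ∈ P.part x → P.part y = P.part x := fun P x y h =>
    P.part_eq_of_mem (P.part_mem.2 (Finset.mem_univ x)) h
  let F : Finpartition (Finset.univ : Finset (Fin n)) → Fin n → Fin n :=
    fun P x => (P.part x).max' (hne P x)
  have hF : ∀ P x, F P x ∈ P.part x := fun P x => Finset.max'_mem _ _
  have hFe : ∀ P x y, P.part x = P.part y → F P x = F P y := by
    intro P x y h; simp only [F, h]
  have hiff : ∀ P x y, y ∈ P.part x ↔ F P y = F P x := by
    intro P x y
    constructor
    · exact fun h => hFe _ _ _ (hpart P x y h)
    · intro h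
      have h1 := hpart P _ _ (hF P x)
      have h2 := hpart P _ _ (hF P y)
      rw [← h1, ← h, h2]
      exact P.mem_part (Finset.mem_univ y)
  refine Nat.card_eq_of_bijective (fun P => ⟨F P, fun x =>
    ⟨Finset.le_max' _ _ (P.mem_part (Finset.mem_univ x)), (hiff P _ _).1 (hF P x)⟩⟩) ⟨?_, ?_⟩
  · intro P Q h
    have h : F P = F Q := congrArg Subtype.val h
    have hp : ∀ x, P.part x = Q.part x := by
      intro x; ext y; rw [hiff, hiff, h]
    have key : ∀ P Q : Finpartition (Finset.univ : Finset (Fin n)),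
        (∀ x, P.part x = Q.part x) → ∀ s ∈ P.parts, s ∈ Q.parts := by
      intro P Q hp s hs
      obtain ⟨x, hx⟩ := P.nonempty_of_mem_parts hs
      rw [← P.part_eq_of_mem hs hx, hp]
      exact Q.part_mem.2 (Finset.mem_univ x)
    ext s
    exact ⟨key P Q hp s, key Q P (fun x => (hp x).symm) s⟩
  · rintro ⟨g, hg⟩
    refine ⟨Finpartition.ofSetoid (Setoid.ker g), Subtype.ext (funext fun x => ?_)⟩
    have hm : ∀ y, y ∈ (Finpartition.ofSetoid (Setoid.ker g)).part x ↔ g x = g y := by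
      intro y
      rw [Finpartition.mem_part_ofSetoid_iff_rel]
      rfl
    apply le_antisymm
    · have := (hm _).1 (hF (Finpartition.ofSetoid (Setoid.ker g)) x)
      change F _ x ≤ g x
      rw [this]
      exact (hg _).1
    · exact Finset.le_max' _ _ ((hm _).2 (hg x).2.symm)

/-- The number of permutations of `{1,…,n}` avoiding 31-4̄-2 is the `n`-th Bell number. -/
theorem card_avoids31bar4dash2_eq_bell (n : ℕ) :
    Nat.card {σ : Equiv.Perm (Fin n) // Avoids31bar4dash2 σ} =
      Nat.card (Finpartition (Finset.univ : Finset (Fin n))) := by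
  rw [card_left, card_right]
end

section
/- For every natural number n, a permutation σ of {1,…,n} simultaneously avoids the barred patterns 3-1̄-42 and 2̄-41-3 if and only if σ is a layered permutation, i.e., there exist an integer m ≥ 0 and indices 0 = b_0 < b_1 < ⋯ < b_m = n such that σ(i) = b_{t−1} + b_t + 1 − i whenever b_{t−1} < i ≤ b_t. -/
/-- `σ` avoids the barred pattern 2̄-41-3 (positions 0-based): for all positions `i`, `j`
with `i+1 < j` and `σ(i+1) < σ(j) < σ(i)`, there is `k < i` with `σ(i+1) < σ(k) < σ(j)`. -/
def AvoidsBar2dash41dash3 {n : ℕ} (σ : Equiv.Perm (Fin n)) : Prop :=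
  ∀ i i' j : Fin n, (i : ℕ) + 1 = (i' : ℕ) → i' < j → σ i' < σ j → σ j < σ i →
    ∃ k : Fin n, k < i ∧ σ i' < σ k ∧ σ k < σ j

/-- `σ` is a layered permutation: there are `m ≥ 0` and indices
`0 = b_0 < b_1 < ⋯ < b_m = n` such that `σ(i) = b_{t-1} + b_t + 1 − i` whenever
`b_{t-1} < i ≤ b_t` (in 1-based terms; here positions and values of the 0-based
encoding are converted to 1-based by adding 1, and the defining equation is written
additively as `σ(i) + i = b_t + b_{t+1} + 1`). -/
def IsLayered {n : ℕ} (σ : Equiv.Perm (Fin n)) : Prop :=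
  ∃ (m : ℕ) (b : ℕ → ℕ), b 0 = 0 ∧ b m = n ∧ (∀ t, t < m → b t < b (t + 1)) ∧
    ∀ (i : Fin n) (t : ℕ), t < m → b t < (i : ℕ) + 1 → (i : ℕ) + 1 ≤ b (t + 1) →
      ((σ i : ℕ) + 1) + ((i : ℕ) + 1) = b t + b (t + 1) + 1

lemma layered_blocks {n : ℕ} {σ : Equiv.Perm (Fin n)} (h : IsLayered σ) :
    ∃ (b : ℕ → ℕ) (t : Fin n → ℕ), (∀ i, b (t i) ≤ i ∧ (i : ℕ) < b (t i + 1)) ∧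
      (∀ i, (σ i : ℕ) + i + 1 = b (t i) + b (t i + 1)) ∧
      (∀ i j, t i < t j → b (t i + 1) ≤ b (t j)) := by
  obtain ⟨m, b, h0, hm, hb, hσ⟩ := h
  have mono : ∀ s t, s ≤ t → t ≤ m → b s ≤ b t := by
    intro s t hst
    induction t, hst using Nat.le_induction with
    | base => intro _; exact le_rfl
    | succ t hst ih =>
      intro htm
      have h1 := ih (by omega)
      have h2 := hb t (by omega)
      omega
  have ex : ∀ i : Fin n, ∃ t, t < m ∧ b t ≤ i ∧ (i : ℕ) < b (t + 1) := by
    intro i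
    have key : ∀ k, k ≤ m → (i : ℕ) < b k → ∃ t, t < m ∧ b t ≤ i ∧ (i : ℕ) < b (t + 1) := by
      intro k
      induction k with
      | zero => intro _ h; omega
      | succ k ih =>
        intro hk hik
        by_cases hc : (i : ℕ) < b k
        · exact ih (by omega) hc
        · exact ⟨k, by omega, by omega, hik⟩
    exact key m le_rfl (by rw [hm]; exact i.2)
  choose t ht1 ht2 ht3 using ex
  refine ⟨b, t, fun i => ⟨ht2 i, ht3 i⟩, ?_, ?_⟩
  · intro i
    have h1 := ht2 i
    have h2 := ht3 i
    have := hσ i (t i) (ht1 i) (by omega) (by omega)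
    omega
  · intro i j hij
    exact mono _ _ hij (ht1 j).le

lemma layered_sandwich {n : ℕ} {σ : Equiv.Perm (Fin n)} (h : IsLayered σ)
    {i j k : Fin n} (hij : i < j) (hjk : j < k) (hki : σ k < σ i) :
    σ j < σ i ∧ σ k < σ j := by
  obtain ⟨b, t, h1, h2, h3⟩ := layered_blocks h
  have hi := h1 i
  have hj := h1 j
  have hk := h1 k
  have ei := h2 i
  have ej := h2 j
  have ek := h2 k
  rw [Fin.lt_def] at *
  rw [Fin.lt_def]
  have hik : t i = t k := by
    rcases lt_trichotomy (t i) (t k) with hc | hc | hc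
    · have := h3 _ _ hc; omega
    · exact hc
    · have := h3 _ _ hc; omega
  have hji : t j = t i := by
    rcases lt_trichotomy (t j) (t i) with hc | hc | hc
    · have := h3 _ _ hc; omega
    · exact hc
    · have := h3 j k
      have := h3 i j hc
      rw [hik] at this
      omega
  rw [hji] at ej
  rw [← hik] at ek
  omega

lemma block_step {n : ℕ} {σ : Equiv.Perm (Fin n)} (hA : Avoids3bar142 σ)
    (hB : AvoidsBar2dash41dash3 σ) (b : ℕ) (hb : b < n)
    (inv : ∀ i : Fin n, (i : ℕ) < b ↔ (σ i : ℕ) < b) :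
    ∀ s, b + s ≤ σ ⟨b, hb⟩ → ∀ i : Fin n, (i : ℕ) = b + s →
      (σ i : ℕ) + s = σ ⟨b, hb⟩ := by
  intro s
  induction s using Nat.strong_induction_on with
  | _ s ih =>
  intro hs i hi
  rcases s with _ | s
  · have : i = ⟨b, hb⟩ := Fin.ext (by simpa using hi)
    rw [this]; rfl
  generalize hv : (σ ⟨b, hb⟩ : ℕ) = v at *
  have hvn : v < n := by rw [← hv]; exact (σ ⟨b, hb⟩).2
  have big : ∀ k : Fin n, b ≤ k → (k : ℕ) ≤ b + s → v - s ≤ σ k := by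
    intro k h1 h2
    have := ih (k - b) (by omega) (by omega) k (by omega)
    omega
  obtain ⟨p, hp⟩ : ∃ p : Fin n, (p : ℕ) = b + s := ⟨⟨b + s, by omega⟩, rfl⟩
  have hpv : (σ p : ℕ) + s = v := ih s (by omega) (by omega) p hp
  have hne : (σ i : ℕ) ≠ σ p := by
    intro h
    have := σ.injective (Fin.ext h)
    rw [this] at hi
    omega
  have hib : b ≤ σ i := by
    have := inv i
    omega
  -- any position with value in `[b, v-s)` lies after `p`
  have after : ∀ k : Fin n, b ≤ σ k → (σ k : ℕ) < v - s → b + s < k := by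
    intro k h1 h2
    by_contra h3
    have := inv k
    have := big k (by omega) (by omega)
    omega
  rcases lt_or_gt_of_ne hne with hlt | hgt
  · by_contra hcon
    obtain ⟨j, hj⟩ := σ.surjective ⟨v - s - 1, by omega⟩
    have hjv : (σ j : ℕ) = v - s - 1 := by rw [hj]
    have hja := after j (by omega) (by omega)
    have hji : (j : ℕ) ≠ i := by
      intro h
      rw [Fin.ext h] at hjv
      omega
    obtain ⟨k, hk1, hk2, hk3⟩ := hB p i j (by omega) (Fin.lt_def.2 (by omega))
      (Fin.lt_def.2 (by omega)) (Fin.lt_def.2 (by omega))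
    rw [Fin.lt_def] at hk1 hk2 hk3
    have := after k (by omega) (by omega)
    omega
  · exfalso
    obtain ⟨q, hq⟩ := σ.surjective ⟨b, hb⟩
    have hqv : (σ q : ℕ) = b := by rw [hq]
    have hqa := after q (by omega) (by omega)
    have hex : ∃ x, ∃ hx : x < n, b + s < x ∧ (σ ⟨x, hx⟩ : ℕ) < v - s :=
      ⟨q, q.2, hqa, by show (σ q : ℕ) < _; omega⟩
    classical
    obtain ⟨hx, hx1, hx2⟩ := Nat.find_spec hex
    have hmin := fun y hy => Nat.find_min hex (m := y) hy
    generalize Nat.find hex = x at *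
    have hxi : x ≠ i := by
      intro h
      have : (⟨x, hx⟩ : Fin n) = i := Fin.ext h
      rw [this] at hx2
      omega
    have hjn : x - 1 < n := by omega
    have hjp : (σ ⟨x - 1, hjn⟩ : ℕ) ≠ σ p := by
      intro h
      have := congrArg Fin.val (σ.injective (Fin.ext h))
      simp only at this
      omega
    have hjv : ¬ (σ ⟨x - 1, hjn⟩ : ℕ) < v - s := fun h =>
      hmin (x - 1) (by omega) ⟨hjn, by omega, h⟩
    obtain ⟨k, hk1, hk2, hk3⟩ := hA p ⟨x - 1, hjn⟩ ⟨x, hx⟩ (Fin.lt_def.2 (by simp only; omega))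
      (by simp only; omega) (Fin.lt_def.2 (by omega)) (Fin.lt_def.2 (by omega))
    rw [Fin.lt_def] at hk1 hk2 hk3
    simp only at hk2
    exact hmin k (by omega) ⟨k.2, by omega, by show (σ k : ℕ) < _; omega⟩

lemma build {n : ℕ} {σ : Equiv.Perm (Fin n)} (hA : Avoids3bar142 σ)
    (hB : AvoidsBar2dash41dash3 σ) : ∀ d b : ℕ, b + d = n →
    (∀ i : Fin n, (i : ℕ) < b ↔ (σ i : ℕ) < b) →
    ∃ (m : ℕ) (c : ℕ → ℕ), c 0 = b ∧ c m = n ∧ (∀ t, t < m → c t < c (t + 1)) ∧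
    ∀ (i : Fin n) (t : ℕ), t < m → c t < (i : ℕ) + 1 → (i : ℕ) + 1 ≤ c (t + 1) →
      ((σ i : ℕ) + 1) + ((i : ℕ) + 1) = c t + c (t + 1) + 1 := by
  intro d
  induction d using Nat.strong_induction_on with
  | _ d ih =>
  intro b hbd inv
  rcases Nat.eq_zero_or_pos d with rfl | hd
  · exact ⟨0, fun _ => b, rfl, by simpa using hbd, by simp, by simp⟩
  have hb : b < n := by omega
  have step := block_step hA hB b hb inv
  have hvb : b ≤ (σ ⟨b, hb⟩ : ℕ) := by
    have := inv ⟨b, hb⟩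
    simp only at this
    omega
  have hvn : (σ ⟨b, hb⟩ : ℕ) < n := (σ ⟨b, hb⟩).2
  generalize (σ ⟨b, hb⟩ : ℕ) = v at *
  have blk : ∀ i : Fin n, b ≤ i → (i : ℕ) ≤ v → (σ i : ℕ) + i = b + v := by
    intro i h1 h2
    have := step (i - b) (by omega) i (by omega)
    omega
  obtain ⟨m, c, h0, hm, hc, hσ⟩ := ih (n - (v + 1)) (by omega) (v + 1) (by omega) (by
    intro i
    have hi := inv i
    constructor
    · intro h
      by_cases hib : (i : ℕ) < b
      · omega
      · have := blk i (by omega) (by omega)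
        omega
    · intro h
      by_cases hib : (i : ℕ) < b
      · omega
      · have hx : b + v - σ i < n := by omega
        have h2 := blk ⟨b + v - σ i, hx⟩ (by simp only; omega) (by simp only; omega)
        simp only at h2
        have h3 : (⟨b + v - σ i, hx⟩ : Fin n) = i := σ.injective (Fin.ext (by omega))
        have h4 := congrArg Fin.val h3
        simp only at h4
        omega)
  refine ⟨m + 1, fun t => Nat.casesOn t b c, rfl, hm, ?_, ?_⟩
  · rintro (_ | t) ht
    · show b < c 0
      omega
    · exact hc t (by omega)
  · rintro i (_ | t) ht h1 h2
    · change b < _ at h1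
      change _ ≤ c 0 at h2
      show _ = b + c 0 + 1
      have := blk i (by omega) (by omega)
      omega
    · exact hσ i t (by omega) h1 h2

theorem avoids_iff_isLayered (n : ℕ) (σ : Equiv.Perm (Fin n)) :
    (Avoids3bar142 σ ∧ AvoidsBar2dash41dash3 σ) ↔ IsLayered σ := by
  constructor
  · rintro ⟨hA, hB⟩
    exact build hA hB n 0 (by omega) (by simp)
  · intro h
    constructor
    · intro i j j' hij hj h1 h2
      have := layered_sandwich h hij (Fin.lt_def.2 (by omega)) h1
      exact absurd this.1 (not_lt.2 h2.le)
    · intro i i' j hi hij h1 h2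
      have := layered_sandwich h (Fin.lt_def.2 (by omega)) hij h2
      exact absurd this.2 (not_lt.2 h1.le)
end

section
/- For every natural number n, a permutation σ of {1,…,n} simultaneously avoids the barred patterns 3-1̄-42 and 31-4̄-2 if and only if σ simultaneously avoids the generalized patterns 23-1 and 3-12. Equivalently, S_n(3-1̄-42, 31-4̄-2) = S_n(23-1, 3-12). -/
/-- First position at which `p` fails. -/
lemma exists_first_step {n : ℕ} (p : Fin n → Prop) (a b : Fin n) (hab : a ≤ b)
    (ha : p a) (hb : ¬ p b) :
    ∃ m m' : Fin n, (m : ℕ) + 1 = (m' : ℕ) ∧ a ≤ m ∧ m' ≤ b ∧ ¬ p m' ∧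
      ∀ x, a ≤ x → x ≤ m → p x := by
  classical
  have hex : ∃ k : ℕ, ∃ h : k < n, (a : ℕ) ≤ k ∧ ¬ p ⟨k, h⟩ := ⟨b, b.2, hab, hb⟩
  obtain ⟨h, h1, h2⟩ := Nat.find_spec hex
  have hmin := fun m => Nat.find_min (H := hex) (m := m)
  have hle : Nat.find hex ≤ b := Nat.find_min' hex ⟨b.2, hab, hb⟩
  generalize Nat.find hex = k at *
  have hne : (a : ℕ) ≠ k := by
    rintro rfl
    exact h2 ha
  refine ⟨⟨k - 1, by omega⟩, ⟨k, h⟩, ?_, ?_, hle, h2, ?_⟩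
  · simp only; omega
  · rw [Fin.le_def]; simp only; omega
  · intro x hx hxm
    rw [Fin.le_def] at hxm
    simp only at hxm
    by_contra hp
    exact hmin x (by omega) ⟨x.2, hx, hp⟩

/-- Last position at which `p` holds. -/
lemma exists_last_step {n : ℕ} (p : Fin n → Prop) (a b : Fin n) (hab : a ≤ b)
    (ha : p a) (hb : ¬ p b) :
    ∃ m m' : Fin n, (m : ℕ) + 1 = (m' : ℕ) ∧ a ≤ m ∧ m' ≤ b ∧ p m ∧
      ∀ x, m' ≤ x → x ≤ b → ¬ p x := by
  obtain ⟨m, m', h1, h2, h3, h4, h5⟩ :=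
    exists_first_step (fun x => ¬ p x.rev) b.rev a.rev (Fin.rev_le_rev.2 hab)
      (by simpa using hb) (by simpa using ha)
  refine ⟨m'.rev, m.rev, ?_, ?_, ?_, by simpa using h4, ?_⟩
  · simp only [Fin.val_rev]; omega
  · simpa using Fin.rev_le_rev.2 h3
  · simpa using Fin.rev_le_rev.2 h2
  · intro x hx hxb
    have := h5 x.rev (Fin.rev_le_rev.2 hxb) (by simpa using Fin.rev_le_rev.2 hx)
    simpa using this

theorem avoids_barred_iff_avoids_generalized (n : ℕ) (σ : Equiv.Perm (Fin n)) :
    (Avoids3bar142 σ ∧ Avoids31bar4dash2 σ) ↔ (Avoids23dash1 σ ∧ Avoids3dash12 σ) := by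
  constructor
  · rintro ⟨hA, hB⟩
    constructor
    · rintro ⟨i, i', j, hi, hij, h1, h2⟩
      obtain ⟨m, m', e, ham, hmb, hp, hall⟩ :=
        exists_first_step (fun x => σ i < σ x) i' j hij.le h2 (not_lt.2 h1.le)
      have hlt : σ m' < σ i := lt_of_le_of_ne (not_lt.1 hp) (by
        intro h
        have := σ.injective h
        subst this
        omega)
      obtain ⟨k, k1, k2, k3⟩ := hA i m m' (by omega) e hlt (hall m ham le_rfl)
      exact absurd (hall k (by omega) k2.le) (not_lt.2 (k3.trans hlt).le)
    · rintro ⟨i, j, j', hij, hj, h1, h2⟩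
      obtain ⟨m, m', e, ham, hmb, hp, hall⟩ :=
        exists_last_step (fun x => σ j' < σ x) i j hij.le h2 (not_lt.2 h1.le)
      have hlt : σ m' < σ j' := lt_of_le_of_ne (not_lt.1 (hall m' le_rfl hmb)) (by
        intro h
        have := σ.injective h
        subst this
        omega)
      obtain ⟨k, k1, k2, k3⟩ := hB m m' j' e (by omega) hlt hp
      exact hall k k1.le (by omega) (hp.trans k3)
  · rintro ⟨hC, hD⟩
    constructor
    · intro i j j' hij hj h1 h2
      by_contra hno
      push Not at hno
      obtain ⟨m, m', e, ham, hmb, hp, hall⟩ :=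
        exists_first_step (fun x => σ x ≤ σ i) i j hij.le le_rfl (not_le.2 h2)
      have hm := hall m ham le_rfl
      refine hC ⟨m, m', j', e, by omega, ?_, hm.trans_lt (not_le.1 hp)⟩
      rcases eq_or_lt_of_le ham with rfl | h
      · exact h1
      · refine lt_of_le_of_ne (hno m h (by omega)) ?_
        intro h
        have := σ.injective h
        subst this
        omega
    · intro i i' j hi hij h1 h2
      by_contra hno
      push Not at hno
      obtain ⟨m, m', e, ham, hmb, hp, hall⟩ :=
        exists_last_step (fun x => σ x < σ j) i' j hij.le h1 (lt_irrefl _)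
      refine hD ⟨i, m, m', by omega, e, hp.trans_le (not_lt.1 (hall m' le_rfl hmb)), ?_⟩
      rcases eq_or_lt_of_le hmb with rfl | h
      · exact h2
      · refine lt_of_le_of_ne (hno m' (by omega) h) ?_
        intro h
        have := σ.injective h
        subst this
        omega
end

section
/- For every natural number n ≥ 1, the number of permutations of {1,…,n} that simultaneously avoid the barred patterns 3-1̄-42 and 3-1̄-24 and whose first entry is 1 equals f(n−1), the total number of permutations of {1,…,n−1} simultaneously avoiding both patterns. That is, f(n,1) = f(n−1). -/
/-- `σ` avoids the barred pattern 3-1̄-24 (positions 0-based): for all `i < j` with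
`j+1 ≤ n` and `σ(j) < σ(i) < σ(j+1)`, there is `k` with `i < k < j` and `σ(k) < σ(j)`. -/
def Avoids3bar124 {n : ℕ} (σ : Equiv.Perm (Fin n)) : Prop :=
  ∀ i j j' : Fin n, i < j → (j : ℕ) + 1 = (j' : ℕ) → σ j < σ i → σ i < σ j' →
    ∃ k : Fin n, i < k ∧ k < j ∧ σ k < σ j

/-- `f n` is the number of permutations of `{1,…,n}` simultaneously avoiding the
barred patterns 3-1̄-42 and 3-1̄-24.  In particular `f 0 = 1`. -/
noncomputable def f (n : ℕ) : ℕ :=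
  Nat.card {σ : Equiv.Perm (Fin n) // Avoids3bar142 σ ∧ Avoids3bar124 σ}

/-- `fk n k` is the number of permutations of `{1,…,n}` simultaneously avoiding the
barred patterns 3-1̄-42 and 3-1̄-24 whose first entry is `k` (1-based value;
the first position is the index `0` of `Fin n`). -/
noncomputable def fk (n k : ℕ) : ℕ :=
  Nat.card {σ : Equiv.Perm (Fin n) //
    (Avoids3bar142 σ ∧ Avoids3bar124 σ) ∧ ∃ i : Fin n, (i : ℕ) = 0 ∧ (σ i : ℕ) + 1 = k}

/-- Prefix the permutation `τ` with a new smallest first entry. -/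
def extendMin {m : ℕ} (τ : Equiv.Perm (Fin m)) : Equiv.Perm (Fin (m + 1)) :=
  Equiv.Perm.decomposeFin.symm (0, τ)

theorem extendMin_zero {m : ℕ} (τ : Equiv.Perm (Fin m)) : extendMin τ 0 = 0 := by
  simp [extendMin]

theorem extendMin_succ {m : ℕ} (τ : Equiv.Perm (Fin m)) (x : Fin m) :
    extendMin τ x.succ = (τ x).succ := by
  simp [extendMin]

theorem avoids142_extendMin {m : ℕ} (τ : Equiv.Perm (Fin m)) :
    Avoids3bar142 (extendMin τ) ↔ Avoids3bar142 τ := by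
  simp [Avoids3bar142, Fin.forall_fin_succ, Fin.exists_fin_succ, extendMin_zero, extendMin_succ]

theorem avoids124_extendMin {m : ℕ} (τ : Equiv.Perm (Fin m)) :
    Avoids3bar124 (extendMin τ) ↔ Avoids3bar124 τ := by
  simp [Avoids3bar124, Fin.forall_fin_succ, Fin.exists_fin_succ, extendMin_zero, extendMin_succ]

theorem fk_one_eq_f_pred (n : ℕ) (hn : 1 ≤ n) : fk n 1 = f (n - 1) := by
  obtain ⟨m, rfl⟩ : ∃ m, n = m + 1 := ⟨n - 1, by omega⟩
  rw [Nat.add_sub_cancel]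
  symm
  unfold f fk
  refine Nat.card_eq_of_bijective
    (fun τ => ⟨extendMin τ.1, ⟨(avoids142_extendMin _).2 τ.2.1, (avoids124_extendMin _).2 τ.2.2⟩,
      0, rfl, by simp [extendMin_zero]⟩) ⟨?_, ?_⟩
  · intro a b h
    have h1 : extendMin a.1 = extendMin b.1 := congrArg Subtype.val h
    have h2 := Equiv.Perm.decomposeFin.symm.injective h1
    exact Subtype.ext (congrArg Prod.snd h2)
  · rintro ⟨σ, ⟨h1, h2⟩, i, hi, hk⟩
    have hi0 : i = 0 := Fin.ext hi
    subst hi0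
    have hσ : σ 0 = 0 := Fin.ext (by simpa using hk)
    obtain ⟨⟨p, τ⟩, rfl⟩ := Equiv.Perm.decomposeFin.symm.surjective σ
    have hp : p = 0 := by simpa using hσ
    subst hp
    exact ⟨⟨τ, (avoids142_extendMin τ).1 h1, (avoids124_extendMin τ).1 h2⟩, rfl⟩
end

section
/- For every natural number n ≥ 1, the number of permutations of {1,…,n} that simultaneously avoid the barred patterns 3-1̄-42 and 3-1̄-24 and whose first entry is n equals f(n−1), the total number of permutations of {1,…,n−1} simultaneously avoiding both patterns. That is, f(n,n) = f(n−1). -/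
/-- Prepend the largest value to a permutation. -/
def extPerm {m : ℕ} (τ : Equiv.Perm (Fin m)) : Equiv.Perm (Fin (m + 1)) :=
  (finSuccEquiv m).trans ((Equiv.optionCongr τ).trans finSuccEquivLast.symm)

theorem extPerm_zero {m : ℕ} (τ : Equiv.Perm (Fin m)) : extPerm τ 0 = Fin.last m := by
  simp [extPerm]

theorem extPerm_succ {m : ℕ} (τ : Equiv.Perm (Fin m)) (i : Fin m) :
    extPerm τ i.succ = (τ i).castSucc := by
  simp [extPerm]

theorem extPerm_injective {m : ℕ} : Function.Injective (extPerm (m := m)) := by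
  intro τ τ' h
  ext i
  have h1 := congrArg (fun e => ((e i.succ : Fin (m + 1)) : ℕ)) h
  simpa [extPerm_succ] using h1

theorem extPerm_surj {m : ℕ} (σ : Equiv.Perm (Fin (m + 1))) (h : σ 0 = Fin.last m) :
    ∃ τ, extPerm τ = σ := by
  have hne : ∀ i : Fin m, σ i.succ ≠ Fin.last m := by
    intro i hi
    rw [← h] at hi
    exact Fin.succ_ne_zero i (σ.injective hi)
  let g : Fin m → Fin m := fun i => (σ i.succ).castPred (hne i)
  have hg : Function.Injective g := by
    intro a b hab
    have h2 : (σ a.succ) = σ b.succ := by simpa [g] using hab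
    exact Fin.succ_injective _ (σ.injective h2)
  refine ⟨Equiv.ofBijective g (Finite.injective_iff_bijective.mp hg), ?_⟩
  refine Equiv.ext fun i => ?_
  refine Fin.cases ?_ (fun i => ?_) i
  · rw [extPerm_zero, h]
  · rw [extPerm_succ]; simp [g]

theorem extPerm_avoids142 {m : ℕ} (τ : Equiv.Perm (Fin m)) :
    Avoids3bar142 (extPerm τ) ↔ Avoids3bar142 τ := by
  constructor
  · intro H i j j' hij hj h1 h2
    obtain ⟨k, hk1, hk2, hk3⟩ := H i.succ j.succ j'.succ (by simpa using hij) (by simp [hj])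
      (by simpa [extPerm_succ] using h1) (by simpa [extPerm_succ] using h2)
    induction k using Fin.cases with
    | zero => simp at hk1
    | succ k => exact ⟨k, by simpa using hk1, by simpa using hk2, by simpa [extPerm_succ] using hk3⟩
  · intro H i j j' hij hj h1 h2
    induction i using Fin.cases with
    | zero => rw [extPerm_zero] at h2; exact absurd h2 (not_lt.mpr (Fin.le_last _))
    | succ i =>
    induction j using Fin.cases with
    | zero => simp at hij
    | succ j =>
    induction j' using Fin.cases with
    | zero => simp at hj
    | succ j' =>
    obtain ⟨k, hk1, hk2, hk3⟩ := H i j j' (by simpa using hij) (by simpa using hj)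
      (by simpa [extPerm_succ] using h1) (by simpa [extPerm_succ] using h2)
    exact ⟨k.succ, by simpa using hk1, by simpa using hk2, by simpa [extPerm_succ] using hk3⟩

theorem extPerm_avoids124 {m : ℕ} (τ : Equiv.Perm (Fin m)) :
    Avoids3bar124 (extPerm τ) ↔ Avoids3bar124 τ := by
  constructor
  · intro H i j j' hij hj h1 h2
    obtain ⟨k, hk1, hk2, hk3⟩ := H i.succ j.succ j'.succ (by simpa using hij) (by simp [hj])
      (by simpa [extPerm_succ] using h1) (by simpa [extPerm_succ] using h2)
    induction k using Fin.cases with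
    | zero => simp at hk1
    | succ k => exact ⟨k, by simpa using hk1, by simpa using hk2, by simpa [extPerm_succ] using hk3⟩
  · intro H i j j' hij hj h1 h2
    induction i using Fin.cases with
    | zero => rw [extPerm_zero] at h2; exact absurd h2 (not_lt.mpr (Fin.le_last _))
    | succ i =>
    induction j using Fin.cases with
    | zero => simp at hij
    | succ j =>
    induction j' using Fin.cases with
    | zero => simp at hj
    | succ j' =>
    obtain ⟨k, hk1, hk2, hk3⟩ := H i j j' (by simpa using hij) (by simpa using hj)
      (by simpa [extPerm_succ] using h1) (by simpa [extPerm_succ] using h2)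
    exact ⟨k.succ, by simpa using hk1, by simpa using hk2, by simpa [extPerm_succ] using hk3⟩

theorem fk_n_eq_f_pred (n : ℕ) (hn : 1 ≤ n) : fk n n = f (n - 1) := by
  obtain ⟨m, rfl⟩ : ∃ m, n = m + 1 := ⟨n - 1, by omega⟩
  rw [Nat.add_sub_cancel]
  unfold fk f
  symm
  refine Nat.card_congr (Equiv.ofBijective (fun τ => ⟨extPerm τ.1,
    ⟨(extPerm_avoids142 _).2 τ.2.1, (extPerm_avoids124 _).2 τ.2.2⟩, 0, rfl,
      by rw [extPerm_zero]; simp⟩) ⟨?_, ?_⟩)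
  · intro a b hab
    exact Subtype.ext (extPerm_injective (congrArg Subtype.val hab))
  · rintro ⟨σ, ⟨h1, h2⟩, i, hi, hσ⟩
    have hi0 : i = 0 := Fin.ext hi
    subst hi0
    obtain ⟨τ, rfl⟩ := extPerm_surj σ (Fin.ext (by simpa using hσ))
    exact ⟨⟨τ, (extPerm_avoids142 _).1 h1, (extPerm_avoids124 _).1 h2⟩, rfl⟩
end

section
/- For every natural number n ≥ 3, there is no permutation of {1,…,n} that simultaneously avoids the barred patterns 3-1̄-42 and 3-1̄-24 and has first entry equal to 2. That is, f(n,2) = 0 for n ≥ 3. -/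
theorem fk_two_eq_zero (n : ℕ) (hn : 3 ≤ n) : fk n 2 = 0 := by
  unfold fk
  rw [Nat.card_eq_zero]
  left
  refine ⟨?_⟩
  rintro ⟨σ, ⟨hA, hB⟩, i, hi, hk⟩
  obtain ⟨p, hp⟩ := σ.surjective ⟨0, by omega⟩
  have hp0 : (σ p : ℕ) = 0 := by rw [hp]
  -- every position other than `i` and `p` carries a value larger than `σ i`
  have big : ∀ q : Fin n, q ≠ i → q ≠ p → σ i < σ q := by
    intro q h1 h2
    have h3 : (σ q : ℕ) ≠ (σ i : ℕ) := fun h => h1 (σ.injective (Fin.ext h))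
    have h4 : (σ q : ℕ) ≠ (σ p : ℕ) := fun h => h2 (σ.injective (Fin.ext h))
    rw [Fin.lt_def]
    omega
  have hlt : σ p < σ i := by
    rw [Fin.lt_def]
    omega
  have hpi : (p : ℕ) ≠ 0 := by
    intro h
    have : p = i := Fin.ext (by omega)
    rw [this] at hlt
    exact lt_irrefl _ hlt
  have hpn := p.isLt
  by_cases h1 : (p : ℕ) = 1
  · obtain ⟨k, -, -, h⟩ := hB i p ⟨2, by omega⟩ (by rw [Fin.lt_def]; omega)
      (by simp only [h1]) hlt
      (big _ (by simp only [ne_eq, Fin.ext_iff]; omega)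
        (by simp only [ne_eq, Fin.ext_iff]; omega))
    rw [Fin.lt_def] at h
    omega
  · obtain ⟨k, -, -, h⟩ := hA i ⟨p - 1, by omega⟩ p (by rw [Fin.lt_def]; simp only; omega)
      (by simp only; omega) hlt
      (big _ (by simp only [ne_eq, Fin.ext_iff]; omega)
        (by simp only [ne_eq, Fin.ext_iff]; omega))
    rw [Fin.lt_def] at h
    omega
end

section
/- For all natural numbers n ≥ 3 and k with 3 ≤ k ≤ n, the counts f(n,k) of permutations of {1,…,n} simultaneously avoiding the barred patterns 3-1̄-42 and 3-1̄-24 with first entry k satisfy the recurrence f(n,k) = f(n,k−1) + f(n−1,k−1) + f(n−2,k−2). -/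
/-- Insert `p` as new first entry in front of `τ`, standardizing the values. -/
def insFirst {n : ℕ} (p : Fin (n + 1)) (τ : Equiv.Perm (Fin n)) : Equiv.Perm (Fin (n + 1)) :=
  ((finSuccEquiv' 0).trans (Equiv.optionCongr τ)).trans (finSuccEquiv' p).symm

lemma insFirst_zero {n : ℕ} (p : Fin (n + 1)) (τ : Equiv.Perm (Fin n)) :
    insFirst p τ 0 = p := by
  simp [insFirst]

lemma insFirst_succ {n : ℕ} (p : Fin (n + 1)) (τ : Equiv.Perm (Fin n)) (i : Fin n) :
    insFirst p τ i.succ = p.succAbove (τ i) := by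
  have h : finSuccEquiv' (0 : Fin (n + 1)) i.succ = some i := by
    rw [← Fin.succAbove_zero_apply, finSuccEquiv'_succAbove]
  simp [insFirst, h]

lemma insFirst_injective {n : ℕ} :
    Function.Injective (fun x : Fin (n + 1) × Equiv.Perm (Fin n) => insFirst x.1 x.2) := by
  rintro ⟨p, τ⟩ ⟨q, ρ⟩ h
  have h : insFirst p τ = insFirst q ρ := h
  have hp : p = q := by rw [← insFirst_zero p τ, h, insFirst_zero]
  subst hp
  congr 1
  ext1 i
  have : insFirst p τ i.succ = insFirst p ρ i.succ := by rw [h]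
  rw [insFirst_succ, insFirst_succ] at this
  exact Fin.succAbove_right_injective this

lemma insFirst_bijective {n : ℕ} :
    Function.Bijective (fun x : Fin (n + 1) × Equiv.Perm (Fin n) => insFirst x.1 x.2) := by
  rw [Fintype.bijective_iff_injective_and_card]
  refine ⟨insFirst_injective, ?_⟩
  simp [Fintype.card_perm, Nat.factorial_succ]

/-- Simultaneous avoidance. -/
def Av {n : ℕ} (σ : Equiv.Perm (Fin n)) : Prop := Avoids3bar142 σ ∧ Avoids3bar124 σ

/-- The conditions involving the first entry. -/
def FirstOk {n : ℕ} (p : ℕ) (τ : Equiv.Perm (Fin n)) : Prop :=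
  (∀ j j' : Fin n, (j : ℕ) + 1 = j' → (τ j' : ℕ) < p → p ≤ τ j → ∃ k, k < j ∧ τ k < τ j') ∧
  (∀ j j' : Fin n, (j : ℕ) + 1 = j' → (τ j : ℕ) < p → p ≤ τ j' → ∃ k, k < j ∧ τ k < τ j)

lemma succAbove_lt_iff_val {n : ℕ} (p : Fin (n + 1)) (x : Fin n) :
    p.succAbove x < p ↔ (x : ℕ) < p := by
  rw [Fin.succAbove_lt_iff_castSucc_lt, Fin.lt_def, Fin.val_castSucc]

lemma lt_succAbove_iff_val {n : ℕ} (p : Fin (n + 1)) (x : Fin n) :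
    p < p.succAbove x ↔ (p : ℕ) ≤ x := by
  rw [Fin.lt_succAbove_iff_le_castSucc, Fin.le_def, Fin.val_castSucc]

lemma av_insFirst {n : ℕ} (p : Fin (n + 1)) (τ : Equiv.Perm (Fin n)) :
    Av (insFirst p τ) ↔ Av τ ∧ FirstOk p τ := by
  unfold Av FirstOk Avoids3bar142 Avoids3bar124
  simp only [Fin.forall_fin_succ, Fin.exists_fin_succ, insFirst_zero, insFirst_succ,
    succAbove_lt_iff_val, lt_succAbove_iff_val, Fin.succAbove_lt_succAbove_iff, Fin.succ_lt_succ_iff,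
    Fin.val_succ, Fin.val_zero, Fin.not_lt_zero, Fin.succ_pos, false_and,
    add_left_inj, false_or, forall_true_left, true_and, IsEmpty.forall_iff, implies_true,
    Nat.add_eq_zero_iff, one_ne_zero, and_false]
  tauto

lemma firstOk_iff {n : ℕ} (p : ℕ) (hp : 1 ≤ p) (τ : Equiv.Perm (Fin (n + 2))) (h : Av τ) :
    FirstOk p τ ↔ ((1 ≤ (τ 0 : ℕ) ∧ (τ 0 : ℕ) < p) ∨ ((τ 0 : ℕ) = 0 ∧ (τ 1 : ℕ) < p)) := by
  obtain ⟨hA, hB⟩ := h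
  have first : ∀ q : ℕ, 1 ≤ q → ∃ t : Fin (n + 2), (τ t : ℕ) < q ∧
      ∀ s, s < t → q ≤ (τ s : ℕ) := by
    intro q hq
    let S : Finset (Fin (n + 2)) := Finset.univ.filter (fun t => (τ t : ℕ) < q)
    have hS : S.Nonempty := ⟨τ.symm 0, by simp [S]; omega⟩
    refine ⟨S.min' hS, ?_, ?_⟩
    · have := S.min'_mem hS
      simpa [S] using this
    · intro s hs
      by_contra hc
      have : s ∈ S := by simp [S]; omega
      exact absurd (S.min'_le s this) (not_le.mpr hs)
  have hne : ∀ j, j ≠ 0 → (τ j : ℕ) ≠ τ 0 := by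
    intro j hj hc
    exact hj (τ.injective (Fin.ext hc))
  constructor
  · rintro ⟨h1, h2⟩
    have h0 : (τ 0 : ℕ) < p := by
      by_contra hc
      obtain ⟨t, ht, hm⟩ := first p hp
      have ht0 : (t : ℕ) ≠ 0 := by
        intro h
        have : t = 0 := Fin.ext h
        subst this
        exact hc ht
      let j : Fin (n + 2) := ⟨t - 1, by omega⟩
      have hj : j < t := by rw [Fin.lt_def]; simp only [j]; omega
      obtain ⟨k, hk, hkt⟩ := h1 j t (by simp [j]; omega) ht (hm j hj)
      have := hm k (hk.trans hj)
      rw [Fin.lt_def] at hkt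
      omega
    by_cases hz : (τ 0 : ℕ) = 0
    · right
      refine ⟨hz, ?_⟩
      by_contra hc
      obtain ⟨k, hk, -⟩ := h2 0 1 (by simp) h0 (not_lt.mp hc)
      exact absurd hk (Fin.not_lt_zero k)
    · left; omega
  · rintro (⟨h1, h2⟩ | ⟨h1, h2⟩)
    · have h10 : (τ 1 : ℕ) < τ 0 := by
        obtain ⟨t, ht, hm⟩ := first (τ 0) h1
        have ht0 : (t : ℕ) ≠ 0 := by
          intro h
          have : t = 0 := Fin.ext h
          subst this
          omega
        by_cases ht1 : (t : ℕ) = 1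
        · have : t = 1 := Fin.ext (by simp [ht1])
          rwa [this] at ht
        exfalso
        let j : Fin (n + 2) := ⟨t - 1, by omega⟩
        have hj : j < t := by rw [Fin.lt_def]; simp only [j]; omega
        have h0j : 0 < j := by rw [Fin.lt_def]; simp only [j, Fin.val_zero]; omega
        have := hm j hj
        have := hne j h0j.ne'
        obtain ⟨k, -, hk, hkt⟩ := hA 0 j t h0j (by simp [j]; omega) (Fin.lt_def.mpr ht)
          (by rw [Fin.lt_def]; omega)
        have := hm k (hk.trans hj)
        rw [Fin.lt_def] at hkt
        omega
      constructor
      · intro j j' hjj ha hb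
        have hj0 : j ≠ 0 := by rintro rfl; omega
        have hj'0 : j' ≠ 0 := by rintro rfl; simp at hjj
        have hj : 0 < j := Fin.pos_iff_ne_zero.mpr hj0
        have := hne j' hj'0
        by_cases hc : (τ 0 : ℕ) < τ j'
        · exact ⟨0, hj, hc⟩
        · obtain ⟨k, -, hk⟩ := hA 0 j j' hj hjj (by rw [Fin.lt_def]; omega)
            (by rw [Fin.lt_def]; omega)
          exact ⟨k, hk⟩
      · intro j j' hjj ha hb
        have hj0 : j ≠ 0 := by
          rintro rfl
          have : j' = 1 := Fin.ext (by simp at hjj ⊢; omega)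
          subst this
          omega
        have hj : 0 < j := Fin.pos_iff_ne_zero.mpr hj0
        have := hne j hj0
        by_cases hc : (τ 0 : ℕ) < τ j
        · exact ⟨0, hj, hc⟩
        · obtain ⟨k, -, hk⟩ := hB 0 j j' hj hjj (by rw [Fin.lt_def]; omega)
            (by rw [Fin.lt_def]; omega)
          exact ⟨k, hk⟩
    · constructor
      · intro j j' hjj ha hb
        have hj0 : j ≠ 0 := by rintro rfl; omega
        have hj'0 : j' ≠ 0 := by rintro rfl; simp at hjj
        have := hne j' hj'0
        exact ⟨0, Fin.pos_iff_ne_zero.mpr hj0, by rw [Fin.lt_def]; omega⟩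
      · intro j j' hjj ha hb
        have hj0 : j ≠ 0 := by
          rintro rfl
          have : j' = 1 := Fin.ext (by simp at hjj ⊢; omega)
          subst this
          omega
        have := hne j hj0
        exact ⟨0, Fin.pos_iff_ne_zero.mpr hj0, by rw [Fin.lt_def]; omega⟩

lemma fk_eq (m v : ℕ) :
    fk (m + 1) (v + 1) =
      Nat.card {σ : Equiv.Perm (Fin (m + 1)) // Av σ ∧ (σ 0 : ℕ) = v} := by
  unfold fk
  refine Nat.card_congr (Equiv.subtypeEquivRight fun σ => ?_)
  refine and_congr Iff.rfl ⟨?_, fun h => ⟨0, rfl, by omega⟩⟩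
  rintro ⟨i, hi, h⟩
  have : i = 0 := Fin.ext hi
  subst this
  omega

/-- Counting permutations with a fixed first entry by deleting it. -/
lemma card_first {m : ℕ} (p : Fin (m + 1)) (P : Equiv.Perm (Fin (m + 1)) → Prop) :
    Nat.card {σ : Equiv.Perm (Fin (m + 1)) // P σ ∧ (σ 0 : ℕ) = p} =
      Nat.card {τ : Equiv.Perm (Fin m) // P (insFirst p τ)} := by
  symm
  refine Nat.card_congr (Equiv.ofBijective
    (fun τ => ⟨insFirst p τ.1, τ.2, by rw [insFirst_zero]⟩) ⟨?_, ?_⟩)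
  · intro a b h
    have h := congrArg Subtype.val h
    have := @insFirst_injective m (p, a.1) (p, b.1) h
    exact Subtype.ext (Prod.ext_iff.mp this).2
  · rintro ⟨σ, h1, h2⟩
    obtain ⟨⟨q, τ⟩, rfl⟩ := insFirst_bijective.2 σ
    simp only [insFirst_zero] at h1 h2
    have : q = p := Fin.ext h2
    subst this
    exact ⟨⟨τ, h1⟩, rfl⟩

lemma card_split {α : Type*} [Finite α] (P Q R : α → Prop) (h : ∀ a, P a ↔ Q a ∨ R a)
    (hd : ∀ a, Q a → ¬ R a) :
    Nat.card {a // P a} = Nat.card {a // Q a} + Nat.card {a // R a} := by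
  classical
  have := Fintype.ofFinite α
  simp only [Nat.card_eq_fintype_card, Fintype.card_subtype]
  rw [← Finset.card_union_of_disjoint]
  · congr 1
    ext a
    simp [h a]
  · rw [Finset.disjoint_filter]
    intro a _ hq
    exact hd a hq

lemma fk_step (m p : ℕ) (hp : 1 ≤ p) (hpm : p ≤ m + 2) :
    fk (m + 3) (p + 1) = Nat.card {τ : Equiv.Perm (Fin (m + 2)) // Av τ ∧
      ((1 ≤ (τ 0 : ℕ) ∧ (τ 0 : ℕ) < p) ∨ ((τ 0 : ℕ) = 0 ∧ (τ 1 : ℕ) < p))} := by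
  rw [fk_eq (m + 2) p, card_first ⟨p, by omega⟩ Av]
  refine Nat.card_congr (Equiv.subtypeEquivRight fun τ => ?_)
  rw [av_insFirst]
  exact and_congr_right fun h => firstOk_iff p hp τ h

lemma fk_third (m p : ℕ) :
    Nat.card {τ : Equiv.Perm (Fin (m + 2)) // (Av τ ∧ (τ 1 : ℕ) = p + 1) ∧ (τ 0 : ℕ) = 0} =
      fk (m + 1) (p + 1) := by
  rw [fk_eq]
  have := card_first (0 : Fin (m + 2)) (fun τ => Av τ ∧ (τ 1 : ℕ) = p + 1)
  rw [Fin.val_zero] at this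
  rw [this]
  refine Nat.card_congr (Equiv.subtypeEquivRight fun ρ => ?_)
  have h1 : insFirst 0 ρ 1 = (ρ 0).succ := by
    have := insFirst_succ 0 ρ 0
    rwa [Fin.succAbove_zero_apply] at this
  rw [av_insFirst, h1]
  simp [FirstOk]

theorem fk_recurrence (n k : ℕ) (hn : 3 ≤ n) (hk3 : 3 ≤ k) (hkn : k ≤ n) :
    fk n k = fk n (k - 1) + fk (n - 1) (k - 1) + fk (n - 2) (k - 2) := by
  obtain ⟨m, rfl⟩ : ∃ m, n = m + 3 := ⟨n - 3, by omega⟩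
  obtain ⟨p, rfl⟩ : ∃ p, k = p + 3 := ⟨k - 3, by omega⟩
  have e1 : p + 3 - 1 = p + 1 + 1 := by omega
  have e2 : p + 3 - 2 = p + 1 := by omega
  have e3 : m + 3 - 1 = m + 1 + 1 := by omega
  have e4 : m + 3 - 2 = m + 1 := by omega
  rw [e1, e2, e3, e4, fk_step m (p + 2) (by omega) (by omega),
    fk_step m (p + 1) (by omega) (by omega), fk_eq (m + 1) (p + 1), ← fk_third m p]
  rw [card_split _ (fun τ : Equiv.Perm (Fin (m + 2)) => (Av τ ∧
      ((1 ≤ (τ 0 : ℕ) ∧ (τ 0 : ℕ) < p + 1) ∨ ((τ 0 : ℕ) = 0 ∧ (τ 1 : ℕ) < p + 1))) ∨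
      (Av τ ∧ (τ 0 : ℕ) = p + 1))
      (fun τ => (Av τ ∧ (τ 1 : ℕ) = p + 1) ∧ (τ 0 : ℕ) = 0)]
  · rw [card_split _ _ _ (fun τ => Iff.rfl)]
    rintro τ ⟨-, h⟩ ⟨-, h'⟩
    omega
  · intro τ
    by_cases h : Av τ
    · simp only [h, true_and]
      omega
    · simp [h]
  · rintro τ (⟨-, h⟩ | ⟨-, h⟩) ⟨⟨-, h'⟩, h''⟩ <;> omega
end

section
/- For every natural number n ≥ 1, the number f(n) of permutations of {1,…,n} simultaneously avoiding the barred patterns 3-1̄-42 and 3-1̄-24 satisfies f(n) = Σ_{m=0}^{n−2} a(n,m)·f(m) + F_{n−1}, where F denotes the Fibonacci sequence with F_0 = F_1 = 1 and a(n,m) are the convolved Fibonacci numbers. -/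
/-- Fibonacci numbers with the indexing `F 0 = F 1 = 1`, `F j = F (j-1) + F (j-2)`
(so `F j = Nat.fib (j+1)`). -/
def F (j : ℕ) : ℕ := Nat.fib (j + 1)

/-- The convolved Fibonacci numbers: for `n ≥ m + 2`,
`a n m = Σ F_{n_0} ⋯ F_{n_m}`, the sum over all `(m+1)`-tuples of naturals with
`n_0 + ⋯ + n_m = n - m - 2`; and `a n m = 0` for `n < m + 2`. -/
def a (n m : ℕ) : ℕ :=
  if n < m + 2 then 0
  else ∑ t ∈ Finset.Nat.antidiagonalTuple (m + 1) (n - m - 2), ∏ i, F (t i)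

/-- Local characterization of the avoiders. -/
def Good {n : ℕ} (σ : Equiv.Perm (Fin n)) : Prop :=
  ∀ i : Fin n, (∀ j, i < j → σ i < σ j) ∨ (∀ j : Fin n, i < j → (j : ℕ) ≤ i + 2 → σ j < σ i)

lemma good_aux {n : ℕ} {σ : Equiv.Perm (Fin n)} (h : Good σ) (j j' : Fin n)
    (hj : (j : ℕ) + 1 = j') : ∀ d : ℕ, ∀ i l : Fin n, (j : ℕ) = i + d + 1 → i < l → σ l < σ i →
    (∃ k, i < k ∧ k < j ∧ σ k < σ j ∧ σ k < σ j') ∨ (σ j < σ i ∧ σ j' < σ i) := by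
  intro d
  induction d with
  | zero =>
    intro i l hd hl hs
    rcases h i with h1 | h1
    · exact absurd (h1 l hl) (not_lt.2 hs.le)
    · right
      refine ⟨h1 j ?_ ?_, h1 j' ?_ ?_⟩ <;> omega
  | succ d ih =>
    intro i l hd hl hs
    rcases h i with h1 | h1
    · exact absurd (h1 l hl) (not_lt.2 hs.le)
    · have hlt : (i : ℕ) + 1 < n := by omega
      let i' : Fin n := ⟨i + 1, hlt⟩
      have hi' : (i' : ℕ) = i + 1 := rfl
      have hii : i < i' := by rw [Fin.lt_def]; omega
      have h2 : σ i' < σ i := h1 i' hii (by omega)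
      by_cases hm : ∀ l', i' < l' → σ i' < σ l'
      · left
        exact ⟨i', hii, by rw [Fin.lt_def]; omega, hm j (by rw [Fin.lt_def]; omega),
          hm j' (by rw [Fin.lt_def]; omega)⟩
      · push Not at hm
        obtain ⟨l', hl', hs'⟩ := hm
        have hs'' : σ l' < σ i' := lt_of_le_of_ne hs' (fun e => hl'.ne' (σ.injective e))
        rcases ih i' l' (by omega) hl' hs'' with ⟨k, hk1, hk2, hk3⟩ | ⟨h3, h4⟩
        · exact Or.inl ⟨k, hii.trans hk1, hk2, hk3⟩
        · exact Or.inr ⟨h3.trans h2, h4.trans h2⟩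

lemma avoids_iff_good {n : ℕ} (σ : Equiv.Perm (Fin n)) :
    (Avoids3bar142 σ ∧ Avoids3bar124 σ) ↔ Good σ := by
  constructor
  · rintro ⟨h1, h2⟩ i
    by_cases hm : ∀ j, i < j → σ i < σ j
    · exact Or.inl hm
    right
    push Not at hm
    obtain ⟨l, hl, hs⟩ := hm
    have hs' : σ l < σ i := lt_of_le_of_ne hs (fun e => hl.ne' (σ.injective e))
    have key : ∀ d : ℕ, ∀ l : Fin n, (l : ℕ) = i + d + 1 → σ l < σ i →
        ∃ m : Fin n, (m : ℕ) = i + 1 ∧ σ m < σ i := by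
      intro d
      induction d using Nat.strong_induction_on with
      | _ d ih =>
        intro l hl hs
        rcases Nat.eq_zero_or_pos d with rfl | hd
        · exact ⟨l, by omega, hs⟩
        · let p : Fin n := ⟨i + d, by omega⟩
          have hp : (p : ℕ) = i + d := rfl
          by_cases hpi : σ p < σ i
          · exact ih (d - 1) (by omega) p (by omega) hpi
          · have hip : i < p := by rw [Fin.lt_def]; omega
            have : σ i < σ p := lt_of_le_of_ne (not_lt.1 hpi) (fun e => hip.ne (σ.injective e))
            obtain ⟨k, hk1, hk2, hk3⟩ := h1 i p l hip (by omega) hs this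
            rw [Fin.lt_def] at hk1 hk2
            exact ih (k - i - 1) (by omega) k (by omega) (hk3.trans hs)
    obtain ⟨m, hm, hms⟩ := key (l - i - 1) l (by rw [Fin.lt_def] at hl; omega) hs'
    intro j hij hj
    rw [Fin.lt_def] at hij
    by_cases hjm : j = m
    · rw [hjm]; exact hms
    · have hjm' : (j : ℕ) ≠ m := fun e => hjm (Fin.ext e)
      by_contra hcon
      have hij' : i ≠ j := fun e => by rw [e] at hij; omega
      have : σ i < σ j := lt_of_le_of_ne (not_lt.1 hcon) (fun e => hij' (σ.injective e))
      obtain ⟨k, hk1, hk2, _⟩ := h2 i m j (by rw [Fin.lt_def]; omega) (by omega) hms this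
      rw [Fin.lt_def] at hk1 hk2
      omega
  · intro h
    refine ⟨?_, ?_⟩
    · intro i j j' hij hj h1 h2
      have hij' := Fin.lt_def.1 hij
      rcases good_aux h j j' hj (j - i - 1) i j' (by omega) (by rw [Fin.lt_def]; omega) h1 with
        ⟨k, a1, a2, a3, a4⟩ | ⟨h3, h4⟩
      · exact ⟨k, a1, a2, a4⟩
      · exact absurd h3 (not_lt.2 h2.le)
    · intro i j j' hij hj h1 h2
      have hij' := Fin.lt_def.1 hij
      rcases good_aux h j j' hj (j - i - 1) i j (by omega) hij h1 with
        ⟨k, a1, a2, a3, a4⟩ | ⟨h3, h4⟩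
      · exact ⟨k, a1, a2, a3⟩
      · exact absurd h4 (not_lt.2 h2.le)

/-- The permutation with first entry `q` and remaining entries order isomorphic to `ρ`. -/
def consPerm {n : ℕ} (q : Fin (n + 1)) (ρ : Equiv.Perm (Fin n)) : Equiv.Perm (Fin (n + 1)) :=
  (finSuccEquiv n).trans ((Equiv.optionCongr ρ).trans (finSuccEquiv' q).symm)

@[simp] lemma consPerm_zero {n : ℕ} (q : Fin (n + 1)) (ρ : Equiv.Perm (Fin n)) :
    consPerm q ρ 0 = q := by simp [consPerm]

@[simp] lemma consPerm_succ {n : ℕ} (q : Fin (n + 1)) (ρ : Equiv.Perm (Fin n)) (i : Fin n) :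
    consPerm q ρ i.succ = q.succAbove (ρ i) := by simp [consPerm]

lemma consPerm_bijective (n : ℕ) : Function.Bijective
    (fun x : Fin (n + 1) × Equiv.Perm (Fin n) => consPerm x.1 x.2) := by
  rw [Fintype.bijective_iff_injective_and_card]
  constructor
  · rintro ⟨q, ρ⟩ ⟨q', ρ'⟩ h
    have h0 := congrArg (fun s : Equiv.Perm (Fin (n + 1)) => s 0) h
    simp only [consPerm_zero] at h0
    subst h0
    have : ρ = ρ' := by
      ext i
      have hi := congrArg (fun s : Equiv.Perm (Fin (n + 1)) => s i.succ) h
      simp only [consPerm_succ] at hi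
      rw [Fin.succAbove_right_injective hi]
    rw [this]
  · simp [Fintype.card_perm, Nat.factorial_succ]

/-- Number of permutations satisfying `P`. -/
noncomputable def num {n : ℕ} (P : Equiv.Perm (Fin n) → Prop) : ℕ := Nat.card {σ // P σ}

lemma num_false {n : ℕ} : num (fun _ : Equiv.Perm (Fin n) => False) = 0 := by simp [num]

lemma num_congr {n : ℕ} {P Q : Equiv.Perm (Fin n) → Prop} (h : ∀ σ, P σ ↔ Q σ) : num P = num Q :=
  congrArg num (funext fun σ => propext (h σ))

lemma card_consPerm (n : ℕ) (P : Equiv.Perm (Fin (n + 1)) → Prop) :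
    num P = ∑ q : Fin (n + 1), num (fun ρ : Equiv.Perm (Fin n) => P (consPerm q ρ)) := by
  classical
  simp only [num, Nat.card_eq_fintype_card, Fintype.card_subtype, Finset.card_filter]
  rw [← Fintype.sum_prod_type' (fun q ρ => if P (consPerm q ρ) then 1 else 0)]
  exact (Fintype.sum_bijective _ (consPerm_bijective n) _ _ (fun x => rfl)).symm

lemma good_consPerm {n : ℕ} (q : Fin (n + 1)) (ρ : Equiv.Perm (Fin n)) :
    Good (consPerm q ρ) ↔ Good ρ ∧
      (q = 0 ∨ ∀ j : Fin n, (j : ℕ) < 2 → (ρ j : ℕ) < q) := by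
  have hsa : ∀ x : Fin n, q.succAbove x < q ↔ (x : ℕ) < q := by
    intro x
    rw [Fin.succAbove_lt_iff_castSucc_lt, Fin.lt_def, Fin.val_castSucc]
  have hsb : ∀ x : Fin n, q < q.succAbove x ↔ (q : ℕ) ≤ x := by
    intro x
    rw [Fin.lt_succAbove_iff_le_castSucc, Fin.le_def, Fin.val_castSucc]
  unfold Good
  rw [Fin.forall_fin_succ, and_comm]
  refine and_congr ?_ ?_
  · refine forall_congr' fun i => or_congr ?_ ?_
    · rw [Fin.forall_fin_succ]
      simp [Fin.succAbove_lt_succAbove_iff]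
    · rw [Fin.forall_fin_succ]
      simp [Fin.succAbove_lt_succAbove_iff]
  · simp only [Fin.forall_fin_succ (n := n), consPerm_zero, consPerm_succ, hsa, hsb, Fin.succ_pos,
      lt_irrefl, false_imp_iff, true_and, true_imp_iff, Fin.val_succ, Fin.val_zero]
    refine or_congr ?_ ?_
    · constructor
      · intro h
        by_contra hq
        have hq' : (q : ℕ) ≠ 0 := fun e => hq (Fin.ext e)
        have := h (ρ.symm ⟨0, by omega⟩)
        simp at this
        exact hq this
      · rintro rfl; simp
    · refine forall_congr' fun j => ?_
      rw [show (j : ℕ) + 1 ≤ 0 + 2 ↔ (j : ℕ) < 2 by omega]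

/-- Good permutations whose first `r` entries are below `p`. -/
noncomputable def cnt (r n p : ℕ) : ℕ :=
  num (fun σ : Equiv.Perm (Fin n) => Good σ ∧ ∀ j : Fin n, (j : ℕ) < r → (σ j : ℕ) < p)

lemma f_eq_card (n : ℕ) : f n = num (fun σ : Equiv.Perm (Fin n) => Good σ) :=
  num_congr avoids_iff_good

lemma f_eq_cnt (n r : ℕ) : f n = cnt r n n := by
  rw [f_eq_card, cnt]
  exact num_congr (by simp)

/-- Number of good permutations of size `n+1` with first entry `q`. -/
noncomputable def first (n q : ℕ) : ℕ := if q = 0 then f n else cnt 2 n q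

lemma cnt_one_succ (n p : ℕ) :
    cnt 1 (n + 1) p = ∑ q ∈ Finset.range (n + 1), if q < p then first n q else 0 := by
  rw [← Fin.sum_univ_eq_sum_range (fun q => if q < p then first n q else 0), cnt, card_consPerm]
  refine Finset.sum_congr rfl fun q _ => ?_
  simp only [good_consPerm, Fin.forall_fin_succ (n := n), consPerm_zero, consPerm_succ, Fin.val_zero,
    Fin.val_succ]
  have : ∀ x : Fin n, ¬ ((x : ℕ) + 1 < 1) := by intro x; omega
  simp only [this, false_imp_iff, implies_true, and_true, zero_lt_one, true_imp_iff]
  by_cases hqp : (q : ℕ) < p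
  · simp only [hqp, and_true, if_true, first]
    by_cases hq : q = 0
    · simp [hq, f_eq_card]
    · have hq' : (q : ℕ) ≠ 0 := fun e => hq (Fin.ext e)
      simp [hq, hq', cnt]
  · simp [hqp, num_false]

lemma cnt_two_succ (n p : ℕ) :
    cnt 2 (n + 1) (p + 1) = ∑ q ∈ Finset.range (n + 1),
      if q = 0 then cnt 1 n p else if q < p + 1 then cnt 2 n q else 0 := by
  rw [← Fin.sum_univ_eq_sum_range
    (fun q => if q = 0 then cnt 1 n p else if q < p + 1 then cnt 2 n q else 0), cnt, card_consPerm]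
  refine Finset.sum_congr rfl fun q _ => ?_
  simp only [good_consPerm, Fin.forall_fin_succ (n := n), consPerm_zero, consPerm_succ, Fin.val_zero,
    Fin.val_succ]
  by_cases hq : q = 0
  · subst hq
    simp only [Fin.val_zero, if_true, cnt]
    refine num_congr fun ρ => ?_
    simp
  · have hq' : (q : ℕ) ≠ 0 := fun e => hq (Fin.ext e)
    simp only [hq, hq', if_false, false_or]
    by_cases hqp : (q : ℕ) < p + 1
    · simp only [hqp, if_true, cnt]
      refine num_congr fun ρ => ?_
      constructor
      · exact fun h => h.1
      · intro h
        refine ⟨h, fun _ => trivial, fun j hj => ?_⟩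
        have h1 := h.2 j (by omega)
        rw [Fin.succAbove_of_castSucc_lt _ _ (by rw [Fin.lt_def]; simpa using h1)]
        simp
        omega
    · simp [hqp, num_false]

lemma cnt_one_step (n p : ℕ) (h : p ≤ n) : cnt 1 (n + 1) (p + 1) = cnt 1 (n + 1) p + first n p := by
  rw [cnt_one_succ, cnt_one_succ]
  have : ∀ q, (if q < p + 1 then first n q else 0) =
      (if q < p then first n q else 0) + (if p = q then first n q else 0) := by
    intro q
    split_ifs <;> omega
  simp only [this, Finset.sum_add_distrib, Finset.sum_ite_eq, Finset.mem_range]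
  rw [if_pos (by omega)]

lemma cnt_two_step (n p : ℕ) (h : p ≤ n) :
    cnt 2 (n + 2) (p + 2) = cnt 2 (n + 2) (p + 1) + cnt 2 (n + 1) (p + 1) + first n p := by
  rw [cnt_two_succ, cnt_two_succ, cnt_one_step n p h]
  have : ∀ q, (if q = 0 then cnt 1 (n + 1) p + first n p
      else if q < p + 1 + 1 then cnt 2 (n + 1) q else 0) =
      (if q = 0 then cnt 1 (n + 1) p else if q < p + 1 then cnt 2 (n + 1) q else 0) +
      (if p + 1 = q then cnt 2 (n + 1) q else 0) + (if 0 = q then first n p else 0) := by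
    intro q
    split_ifs <;> omega
  simp only [this, Finset.sum_add_distrib, Finset.sum_ite_eq, Finset.mem_range]
  rw [if_pos (by omega), if_pos (by omega)]

lemma cnt_two_one (n : ℕ) : cnt 2 (n + 1) 1 = if n = 0 then 1 else 0 := by
  rw [cnt_two_succ, Finset.sum_eq_single 0]
  · simp only [if_true]
    rcases n with _ | n
    · simp [cnt, num, Good]
    · simp [cnt_one_succ]
  · intro b _ hb
    simp [hb]
  · simp

open PowerSeries

/-- Fibonacci series. -/
noncomputable def PF : ℤ⟦X⟧ := PowerSeries.mk fun j => (F j : ℤ)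

/-- Diagonal series. -/
noncomputable def HS (d : ℕ) : ℤ⟦X⟧ := PowerSeries.mk fun j => (cnt 2 (j + d + 1) (j + 1) : ℤ)

lemma PF_eq : PF = 1 + X * PF + X * (X * PF) := by
  ext j
  rcases j with _ | _ | j
  · simp [PF, F]
  · simp [PF, F, coeff_succ_X_mul, coeff_one]
  · simp only [PF, F, map_add, coeff_succ_X_mul, coeff_one, coeff_mk]
    rw [Nat.fib_add_two (n := j + 1)]
    simp
    ring

lemma HS_eq (d : ℕ) : HS d = (if d = 0 then 1 else 0) + C (f d : ℤ) * X + X * HS (d + 1) + X * HS d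
    + X * (X * HS d) := by
  ext j
  rcases j with _ | _ | j
  · simp only [HS, coeff_mk, map_add, zero_add, cnt_two_one]
    split_ifs <;> simp
  · have := cnt_two_step d 0 (by omega)
    simp only [HS, coeff_mk, map_add, coeff_succ_X_mul, coeff_C_mul, coeff_X]
    rw [show 0 + 1 + d + 1 = d + 2 by ring, this, show 0 + (d + 1) + 1 = d + 2 by ring]
    have h2 : coeff (0 + 1) (if d = 0 then (1 : ℤ⟦X⟧) else 0) = 0 := by
      split_ifs <;> simp [coeff_one]
    rw [h2]
    simp [first]
    ring
  · have := cnt_two_step (j + 1 + d) (j + 1) (by omega)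
    simp only [HS, coeff_mk, map_add, coeff_succ_X_mul, coeff_C_mul, coeff_X]
    rw [show j + 1 + 1 + d + 1 = j + 1 + d + 2 by ring, this,
      show j + 1 + (d + 1) + 1 = j + 1 + d + 2 by ring]
    have h2 : coeff (j + 1 + 1) (if d = 0 then (1 : ℤ⟦X⟧) else 0) = 0 := by
      split_ifs <;> simp [coeff_one]
    rw [h2]
    simp [first]
    try rw [show j + 1 + d = j + d + 1 by ring]
    try ring

lemma HS_eq' (d : ℕ) :
    HS d = PF * ((if d = 0 then 1 else 0) + C (f d : ℤ) * X + X * HS (d + 1)) := by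
  linear_combination PF * HS_eq d - HS d * PF_eq

lemma HS_iter (N : ℕ) : HS 0 = PF + ∑ m ∈ Finset.range N, C (f m : ℤ) * (X ^ (m + 1) * PF ^ (m + 1))
    + X ^ N * (PF ^ N * (HS N - if N = 0 then PF else 0)) := by
  induction N with
  | zero => simp
  | succ N ih =>
    rw [ih, Finset.sum_range_succ]
    have h := HS_eq' N
    rw [if_neg (Nat.succ_ne_zero N)]
    split_ifs at h ⊢
    · linear_combination X ^ N * PF ^ N * h
    · linear_combination X ^ N * PF ^ N * h

lemma coeff_PF_pow (r s : ℕ) : coeff s (PF ^ r) =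
    ((∑ t ∈ Finset.Nat.antidiagonalTuple r s, ∏ i, F (t i) : ℕ) : ℤ) := by
  have : PF ^ r = ∏ _i : Fin r, PF := by simp
  rw [this, PowerSeries.coeff_prod]
  push_cast
  refine Finset.sum_bij (fun l _ => (l : Fin r → ℕ)) ?_ ?_ ?_ ?_
  · intro l hl
    rw [Finset.mem_finsuppAntidiag] at hl
    rw [Finset.Nat.mem_antidiagonalTuple]
    exact hl.1
  · intro l _ l' _ h
    exact DFunLike.coe_injective h
  · intro t ht
    refine ⟨Finsupp.equivFunOnFinite.symm t, ?_, by simp⟩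
    rw [Finset.Nat.mem_antidiagonalTuple] at ht
    rw [Finset.mem_finsuppAntidiag]
    exact ⟨by simpa using ht, by simp⟩
  · intro l _
    simp [PF]

theorem f_eq_sum_convolved_fib (n : ℕ) (hn : 1 ≤ n) :
    f n = (∑ m ∈ Finset.range (n - 1), a n m * f m) + F (n - 1) := by
  obtain ⟨k, rfl⟩ : ∃ k, n = k + 1 := ⟨n - 1, by omega⟩
  have h := congrArg (coeff k) (HS_iter (k + 1))
  simp only [Nat.add_sub_cancel]
  rw [Finset.sum_range_succ] at h
  simp only [map_add, map_sum, coeff_C_mul, coeff_X_pow_mul', coeff_PF_pow] at h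
  rw [if_neg (by omega), if_neg (by omega)] at h
  have h0 : coeff k (HS 0) = (f (k + 1) : ℤ) := by
    rw [f_eq_cnt (k + 1) 2]; simp [HS]
  rw [h0] at h
  have h1 : coeff k PF = (F k : ℤ) := by simp [PF]
  rw [h1] at h
  zify
  rw [h, mul_zero, add_zero, add_zero, add_comm]
  congr 1
  refine Finset.sum_congr rfl fun m hm => ?_
  rw [Finset.mem_range] at hm
  rw [if_pos (by omega), a, if_neg (by omega), mul_comm, show k + 1 - m - 2 = k - (m + 1) by omega]
end

section
/- The convolved Fibonacci numbers a(n,m) satisfy the recurrence a(n,m) = a(n−1,m−1) + a(n−1,m) + a(n−2,m) for all n ≥ 3 and m ≥ 1, and a(n,0) = a(n−1,0) + a(n−2,0) for all n ≥ 3. -/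
/-- Sum over all `k`-tuples with total `N`. -/
def convS (k N : ℕ) : ℕ := ∑ t ∈ Finset.Nat.antidiagonalTuple k N, ∏ i, F (t i)

theorem convS_succ (k N : ℕ) :
    convS (k + 1) N = ∑ p ∈ Finset.HasAntidiagonal.antidiagonal N, F p.1 * convS k p.2 := by
  unfold convS
  simp_rw [Finset.mul_sum]
  rw [Finset.sum_sigma']
  refine Finset.sum_bij' (fun t _ => ⟨(t 0, ∑ i : Fin k, t i.succ), fun i => t i.succ⟩)
    (fun x _ => Fin.cons x.1.1 x.2) ?_ ?_ ?_ ?_ ?_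
  · intro t ht
    rw [Finset.Nat.mem_antidiagonalTuple, Fin.sum_univ_succ] at ht
    simp [Finset.Nat.mem_antidiagonalTuple, ht]
  · rintro ⟨⟨i, j⟩, u⟩ hx
    simp only [Finset.mem_sigma, Finset.HasAntidiagonal.mem_antidiagonal, Finset.Nat.mem_antidiagonalTuple] at hx
    rw [Finset.Nat.mem_antidiagonalTuple, Fin.sum_univ_succ]
    simp [hx.1, hx.2]
  · intro t ht
    exact Fin.cons_self_tail t
  · rintro ⟨⟨i, j⟩, u⟩ hx
    simp only [Finset.mem_sigma, Finset.HasAntidiagonal.mem_antidiagonal, Finset.Nat.mem_antidiagonalTuple] at hx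
    simp [hx.2]
  · intro t ht
    rw [Fin.prod_univ_succ]

theorem F_add_two (j : ℕ) : F (j + 2) = F (j + 1) + F j := by
  unfold F
  rw [Nat.fib_add_two (n := j + 1), add_comm]

theorem convS_at_zero (k : ℕ) : convS (k + 1) 0 = convS k 0 := by
  simp [convS_succ, F]

theorem convS_at_one (k : ℕ) : convS (k + 1) 1 = convS k 1 + convS (k + 1) 0 := by
  simp [convS_succ, F, Finset.Nat.antidiagonal_succ]

theorem convS_rec (k N : ℕ) :
    convS (k + 1) (N + 2) = convS k (N + 2) + convS (k + 1) (N + 1) + convS (k + 1) N := by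
  have h0 : F 0 = 1 := rfl
  have h1 : F 1 = 1 := rfl
  simp only [convS_succ]
  rw [Finset.Nat.sum_antidiagonal_succ, Finset.Nat.sum_antidiagonal_succ,
    Finset.Nat.sum_antidiagonal_succ]
  simp only [zero_add, h0, h1, one_mul, add_assoc, Nat.reduceAdd, F_add_two, add_mul,
    Finset.sum_add_distrib]

theorem convS_zero_succ (N : ℕ) : convS 0 (N + 1) = 0 := by
  simp [convS]

theorem a_lt {n m : ℕ} (h : n < m + 2) : a n m = 0 := if_pos h

theorem a_eq (N m : ℕ) : a (N + (m + 2)) m = convS (m + 1) N := by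
  unfold a convS
  rw [if_neg (by omega), show N + (m + 2) - m - 2 = N by omega]

theorem a_eq_of {n m : ℕ} (N : ℕ) (h : n = N + (m + 2)) : a n m = convS (m + 1) N := by
  rw [h, a_eq]

theorem convolved_fib_recurrence :
    (∀ n m : ℕ, 3 ≤ n → 1 ≤ m → a n m = a (n - 1) (m - 1) + a (n - 1) m + a (n - 2) m) ∧
      (∀ n : ℕ, 3 ≤ n → a n 0 = a (n - 1) 0 + a (n - 2) 0) := by
  constructor
  · intro n m hn hm
    obtain ⟨m, rfl⟩ := Nat.exists_eq_add_of_le' hm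
    rw [Nat.add_sub_cancel]
    by_cases h : n < m + 1 + 2
    · rw [a_lt h, a_lt (by omega), a_lt (by omega), a_lt (by omega)]
    obtain ⟨N, rfl⟩ := Nat.exists_eq_add_of_le' (not_lt.mp h)
    match N with
    | 0 =>
      rw [a_eq, a_eq_of 0 (by omega), a_lt (by omega), a_lt (by omega), convS_at_zero]; rfl
    | 1 =>
      rw [a_eq, a_eq_of 1 (by omega), a_eq_of 0 (by omega), a_lt (by omega), convS_at_one]; rfl
    | N + 2 =>
      rw [a_eq, a_eq_of (N + 2) (by omega), a_eq_of (N + 1) (by omega), a_eq_of N (by omega), convS_rec]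
  · intro n hn
    obtain ⟨N, rfl⟩ := Nat.exists_eq_add_of_le' hn
    match N with
    | 0 =>
      rw [a_eq_of 1 (by omega), a_eq_of 0 (by omega), a_lt (by omega), convS_at_one, convS_zero_succ]
      simp
    | N + 1 =>
      rw [a_eq_of (N + 2) (by omega), a_eq_of (N + 1) (by omega), a_eq_of N (by omega), convS_rec,
        convS_zero_succ]
      simp
end
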